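/- arXiv:1503.03850 — 2 statements merged into one kernel-verified Lean document; each statement's English description precedes it below -/
import Mathlib

section
/- Let N ≥ 0 and let Γ be an irreducible subgroup of Diff₊(I) such that every non-identity element of Γ has at most N fixed points in the open interval (0,1). Then Γ is isomorphic (as an abstract group) to a subgroup of Aff₊(ℝ). -/
open Set

noncomputable section

/-- The group of orientation-preserving homeomorphisms of `I = [0,1]` (each fixing the
endpoints), modeled as order-isomorphisms of the unit interval. -/
abbrev HomeoI : Type := ↥unitInterval ≃o ↥unitInterval

/-- `f` is an orientation-preserving `C¹` diffeomorphism of `I = [0,1]`: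
it extends to a function `F` which is `C¹` on `[0,1]` with everywhere positive
derivative there.  Membership in `HomeoI` already guarantees that it is an
orientation-preserving bijection of `[0,1]` fixing `0` and `1`. -/
def IsC1DiffeoI (f : HomeoI) : Prop :=
  ∃ F : ℝ → ℝ, ContDiffOn ℝ 1 F (Set.Icc 0 1) ∧ (∀ x : ↥unitInterval, F x = (f x : ℝ)) ∧
    ∀ x ∈ Set.Icc (0 : ℝ) 1, 0 < derivWithin F (Set.Icc 0 1) x

/-- The set of fixed points of `f` lying in the open interval `(0,1)`. -/
def interiorFixedPts (f : HomeoI) : Set ↥unitInterval :=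
  {x | f x = x ∧ 0 < (x : ℝ) ∧ (x : ℝ) < 1}

/-- A subgroup of homeomorphisms of `[0,1]` is irreducible if no point of `(0,1)` is
fixed by every element. -/
def IrreducibleSubgroup (Γ : Subgroup HomeoI) : Prop :=
  ∀ x : ↥unitInterval, 0 < (x : ℝ) → (x : ℝ) < 1 → ∃ f ∈ Γ, f x ≠ x

/-- `f : ℝ ≃o ℝ` is an orientation-preserving affine map `x ↦ a*x + b`, `a > 0`. -/
def IsAffinePos (f : ℝ ≃o ℝ) : Prop :=
  ∃ a b : ℝ, 0 < a ∧ ∀ x : ℝ, f x = a * x + b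

/-- `Γ` is isomorphic (as an abstract group) to a subgroup of `Aff₊(ℝ)`, the group of
orientation-preserving affine maps of the real line. -/
def IsIsomorphicToAffineSubgroup (Γ : Subgroup HomeoI) : Prop :=
  ∃ φ : ↥Γ →* (ℝ ≃o ℝ), Function.Injective φ ∧ ∀ γ : ↥Γ, IsAffinePos (φ γ)


theorem holder_comm {G : Type*} [Group G] [LinearOrder G] [MulLeftMono G] [MulRightMono G]
    (arch : ∀ a b : G, 1 < a → ∃ n : ℕ, b ≤ a ^ n) : ∀ a b : G, a * b = b * a := by
  have floor : ∀ c a : G, 1 < c → 1 ≤ a → ∃ n : ℕ, c ^ n ≤ a ∧ a < c ^ (n + 1) := by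
    intro c a hc ha
    have hex : ∃ n : ℕ, a < c ^ n := by
      obtain ⟨n, hn⟩ := arch c a hc
      refine ⟨n + 1, hn.trans_lt ?_⟩
      rw [pow_succ]
      exact lt_mul_of_one_lt_right' _ hc
    classical
    have h1 := Nat.find_spec hex
    have h0 : Nat.find hex ≠ 0 := by
      intro h
      rw [h, pow_zero] at h1
      exact absurd h1 (not_lt.mpr ha)
    obtain ⟨k, hk⟩ := Nat.exists_eq_succ_of_ne_zero h0
    refine ⟨k, ?_, ?_⟩
    · have := Nat.find_min hex (m := k) (by omega)
      exact not_lt.mp this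
    · rw [hk] at h1; exact h1
  have key : ∀ a b : G, 1 ≤ a → 1 ≤ b → a * b = b * a := by
    by_cases hd : ∃ e : G, 1 < e ∧ ∀ x : G, 1 < x → e ≤ x
    · obtain ⟨e, he, hmin⟩ := hd
      have cyc : ∀ a : G, 1 ≤ a → ∃ n : ℕ, a = e ^ n := by
        intro a ha
        obtain ⟨n, h1, h2⟩ := floor e a he ha
        refine ⟨n, ?_⟩
        rcases h1.eq_or_lt with h | h
        · exact h.symm
        · exfalso
          have h3 : 1 < (e ^ n)⁻¹ * a := by
            rw [lt_inv_mul_iff_mul_lt, mul_one]; exact h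
          have h4 := hmin _ h3
          rw [le_inv_mul_iff_mul_le, ← pow_succ] at h4
          exact absurd h2 (not_lt.mpr h4)
      intro a b ha hb
      obtain ⟨n, rfl⟩ := cyc a ha
      obtain ⟨m, rfl⟩ := cyc b hb
      rw [← pow_add, ← pow_add, add_comm]
    · push Not at hd
      have half : ∀ e : G, 1 < e → ∃ c : G, 1 < c ∧ c * c ≤ e := by
        intro e he
        obtain ⟨x, hx1, hxe⟩ := hd e he
        by_cases h : x * x ≤ e
        · exact ⟨x, hx1, h⟩
        · push Not at h
          have hc : e * x⁻¹ < x := by rwa [mul_inv_lt_iff_lt_mul]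
          refine ⟨e * x⁻¹, ?_, ?_⟩
          · rw [lt_mul_inv_iff_mul_lt, one_mul]; exact hxe
          · calc e * x⁻¹ * (e * x⁻¹) ≤ e * x⁻¹ * x := mul_le_mul_right hc.le _
              _ = e := by simp
      have main : ∀ a b : G, 1 ≤ a → 1 ≤ b → ¬ (b * a < a * b) := by
        intro a b ha hb hlt
        have he : 1 < a * b * (b * a)⁻¹ := by
          rw [lt_mul_inv_iff_mul_lt, one_mul]; exact hlt
        obtain ⟨c, hc1, hc2⟩ := half _ he
        obtain ⟨m, hm1, hm2⟩ := floor c a hc1 ha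
        obtain ⟨n, hn1, hn2⟩ := floor c b hc1 hb
        have h1 : a * b < c ^ (m + 1) * c ^ (n + 1) :=
          (mul_lt_mul_of_lt_of_lt hm2 hn2)
        have h2 : c ^ n * c ^ m ≤ b * a := mul_le_mul' hn1 hm1
        have h3 : c ^ (m + 1) * c ^ (n + 1) = c * c * (c ^ n * c ^ m) := by
          rw [← pow_add, ← pow_add, ← pow_two, ← pow_add]; congr 1; ring
        have h4 : c * c * (c ^ n * c ^ m) ≤ a * b * (b * a)⁻¹ * (b * a) := mul_le_mul' hc2 h2
        rw [← h3, inv_mul_cancel_right] at h4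
        exact absurd h1 (not_lt.mpr h4)
      intro a b ha hb
      exact le_antisymm (not_lt.mp (main a b ha hb)) (not_lt.mp (main b a hb ha))
  intro a b
  have comm_inv : ∀ x y : G, x⁻¹ * y = y * x⁻¹ → x * y = y * x := by
    intro x y h
    have := (Commute.inv_left_iff (a := x) (b := y)).mp h
    exact this
  rcases le_total 1 a with ha | ha <;> rcases le_total 1 b with hb | hb
  · exact key a b ha hb
  · exact (comm_inv b a (key _ _ (one_le_inv'.mpr hb) ha)).symm
  · exact comm_inv a b (key _ _ (one_le_inv'.mpr ha) hb)
  · apply comm_inv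
    refine (comm_inv _ _ ?_).symm
    exact key _ _ (one_le_inv'.mpr hb) (one_le_inv'.mpr ha)

theorem holder_embed {G : Type*} [Group G] [LinearOrder G] [MulLeftMono G] [MulRightMono G]
    (arch : ∀ a b : G, 1 < a → ∃ n : ℕ, b ≤ a ^ n) :
    ∃ ι : G → ℝ, (∀ a b, ι (a * b) = ι a + ι b) ∧ ∀ a b, a < b → ι a < ι b := by
  have hc := holder_comm arch
  let _ : CommGroup G := { (inferInstance : Group G) with mul_comm := hc }
  have : IsOrderedMonoid G := ⟨fun a b h c => mul_le_mul_left h c, fun a b h c => mul_le_mul_right h c⟩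
  have : Archimedean (Additive G) := ⟨fun x y hy => arch (Additive.toMul y) (Additive.toMul x) hy⟩
  obtain ⟨f, hf⟩ := Archimedean.exists_orderAddMonoidHom_real_injective (Additive G)
  refine ⟨fun g => f (Additive.ofMul g), fun a b => ?_, fun a b hab => ?_⟩
  · exact map_add f (Additive.ofMul a) (Additive.ofMul b)
  · have hle : f (Additive.ofMul a) ≤ f (Additive.ofMul b) := f.monotone' (show a ≤ b from hab.le)
    refine lt_of_le_of_ne hle fun h => hab.ne ?_
    exact Additive.ofMul.injective (hf h)

theorem scale_unique {G : Type*} [Group G] [LinearOrder G] [MulLeftMono G] [MulRightMono G]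
    (f g : G → ℝ) (hf : ∀ a b, f (a * b) = f a + f b) (hf' : ∀ a b, a < b → f a < f b)
    (hg : ∀ a b, g (a * b) = g a + g b) (hg' : ∀ a b, a < b → g a < g b)
    (c : G) (hc : 1 < c) (x : G) : g x = g c / f c * f x := by
  have one : ∀ f : G → ℝ, (∀ a b, f (a * b) = f a + f b) → f 1 = 0 := by
    intro f h; have := h 1 1; rw [mul_one] at this; linarith
  have pw : ∀ f : G → ℝ, (∀ a b, f (a * b) = f a + f b) → ∀ (a : G) (n : ℤ), f (a ^ n) = n * f a := by
    intro f h a n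
    let F : G →* Multiplicative ℝ :=
      { toFun := fun a => Multiplicative.ofAdd (f a), map_one' := by simp [one f h],
        map_mul' := fun a b => by simp [h] }
    have := map_zpow F a n
    have h2 := congrArg Multiplicative.toAdd this
    simpa [F] using h2
  have main : ∀ f g : G → ℝ, (∀ a b, f (a * b) = f a + f b) → (∀ a b, a < b → f a < f b) →
      (∀ a b, g (a * b) = g a + g b) → (∀ a b, a < b → g a < g b) → ¬ (f x / f c < g x / g c) := by
    intro f g hf hf' hg hg' h
    have fc : 0 < f c := by have := hf' 1 c hc; rwa [one f hf] at this
    have gc : 0 < g c := by have := hg' 1 c hc; rwa [one g hg] at this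
    obtain ⟨q, hq1, hq2⟩ := exists_rat_btwn h
    have hden : (0 : ℝ) < q.den := by exact_mod_cast q.den_pos
    have hqe : (q : ℝ) = q.num / q.den := by exact_mod_cast (Rat.num_div_den q).symm
    rw [hqe] at hq1 hq2
    rw [div_lt_div_iff₀ fc hden] at hq1
    rw [div_lt_div_iff₀ hden gc] at hq2
    have h1 : f (x ^ (q.den : ℤ)) < f (c ^ q.num) := by
      rw [pw f hf, pw f hf]; push_cast; linarith
    have h2 : g (c ^ q.num) < g (x ^ (q.den : ℤ)) := by
      rw [pw g hg, pw g hg]; push_cast; linarith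
    rcases lt_trichotomy (x ^ (q.den : ℤ)) (c ^ q.num) with h3 | h3 | h3
    · exact absurd (hg' _ _ h3) (not_lt.mpr h2.le)
    · rw [h3] at h1; exact lt_irrefl _ h1
    · exact absurd (hf' _ _ h3) (not_lt.mpr h1.le)
  have fc : 0 < f c := by have := hf' 1 c hc; rwa [one f hf] at this
  have gc : 0 < g c := by have := hg' 1 c hc; rwa [one g hg] at this
  have h := le_antisymm (not_lt.mp (main f g hf hf' hg hg')) (not_lt.mp (main g f hg hg' hf hf'))
  field_simp at h ⊢
  linarith

/-- affine order isomorphism -/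
noncomputable def affIso (a b : ℝ) (ha : 0 < a) : ℝ ≃o ℝ where
  toFun x := a * x + b
  invFun y := (y - b) / a
  left_inv x := by field_simp; ring
  right_inv y := by field_simp; ring
  map_rel_iff' := by
    intro x y
    simp [ha]

theorem affine_of_cocycle {G : Type*} [Group G] (lam τ : G → ℝ) (hpos : ∀ g, 0 < lam g)
    (hmul : ∀ g h, lam (g * h) = lam g * lam h) (hτ : ∀ g h, τ (g * h) = τ g + lam g * τ h)
    (hinj : ∀ g, lam g = 1 → τ g = 0 → g = 1) :
    ∃ φ : G →* (ℝ ≃o ℝ), Function.Injective φ ∧ ∀ γ, ∃ a b : ℝ, 0 < a ∧ ∀ x : ℝ, φ γ x = a * x + b := by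
  have h1 : lam 1 = 1 := by
    have := hmul 1 1; rw [mul_one] at this
    have h := hpos 1
    field_simp at this; linarith
  have t1 : τ 1 = 0 := by
    have := hτ 1 1; rw [mul_one, h1] at this; linarith
  let φ : G →* (ℝ ≃o ℝ) :=
    { toFun := fun g => affIso (lam g) (τ g) (hpos g)
      map_one' := by ext x; simp [affIso, h1, t1]
      map_mul' := by
        intro g h; ext x
        change lam (g * h) * x + τ (g * h) = lam g * (lam h * x + τ h) + τ g
        rw [hmul, hτ]; ring }
  refine ⟨φ, ?_, fun γ => ⟨lam γ, τ γ, hpos γ, fun x => rfl⟩⟩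
  rw [injective_iff_map_eq_one]
  intro g hg
  have e0 : lam g * 0 + τ g = 0 := by
    have := congrArg (fun f : ℝ ≃o ℝ => f 0) hg; exact this
  have e1 : lam g * 1 + τ g = 1 := by
    have := congrArg (fun f : ℝ ≃o ℝ => f 1) hg; exact this
  exact hinj g (by linarith) (by linarith)

theorem affine_of_normal {G : Type*} [Group G] (C : Subgroup G) [hC : C.Normal]
    (ι : C → ℝ) (hι : ∀ a b, ι (a * b) = ι a + ι b) (hinj : ∀ c, ι c = 0 → c = 1)
    (hne : ∃ c : C, c ≠ 1)
    (lam : G → ℝ) (hpos : ∀ g, 0 < lam g)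
    (hlam : ∀ g (c : C), ι ⟨g * c * g⁻¹, hC.conj_mem c c.2 g⟩ = lam g * ι c)
    (hker : ∀ g, lam g = 1 → g ∈ C) :
    ∃ φ : G →* (ℝ ≃o ℝ), Function.Injective φ ∧ ∀ γ, ∃ a b : ℝ, 0 < a ∧ ∀ x : ℝ, φ γ x = a * x + b := by
  obtain ⟨c0, hc0⟩ := hne
  have hc0' : ι c0 ≠ 0 := fun h => hc0 (hinj _ h)
  have hmul : ∀ g h, lam (g * h) = lam g * lam h := by
    intro g h
    have e1 := hlam (g * h) c0
    have e2 := hlam g ⟨h * c0 * h⁻¹, hC.conj_mem c0 c0.2 h⟩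
    rw [hlam h c0] at e2
    have e3 : (⟨g * h * c0 * (g * h)⁻¹, hC.conj_mem c0 c0.2 (g * h)⟩ : C)
        = ⟨g * (h * c0 * h⁻¹) * g⁻¹, hC.conj_mem _ (hC.conj_mem c0 c0.2 h) g⟩ := by
      apply Subtype.ext; simp only; group
    rw [e3, e2] at e1
    have : (lam (g * h) - lam g * lam h) * ι c0 = 0 := by linarith
    rcases mul_eq_zero.mp this with h | h
    · linarith
    · exact absurd h hc0'
  have ι1 : ι 1 = 0 := by have := hι 1 1; rw [mul_one] at this; linarith
  by_cases hall : ∀ g, lam g = 1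
  · refine affine_of_cocycle lam (fun g => ι ⟨g, hker g (hall g)⟩) hpos hmul ?_ ?_
    · intro g h
      rw [hall g, one_mul, ← hι]; rfl
    · intro g _ h
      have := hinj _ h
      exact congrArg Subtype.val this
  · push Not at hall
    obtain ⟨γ, hγ⟩ := hall
    have hinv : ∀ g, lam g * lam g⁻¹ = 1 := by
      intro g
      rw [← hmul, mul_inv_cancel]
      have := hmul 1 1; rw [mul_one] at this
      have h := hpos 1
      field_simp at this; linarith
    have hcm : ∀ g, g * γ * g⁻¹ * γ⁻¹ ∈ C := by
      intro g; apply hker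
      rw [hmul, hmul, hmul]
      calc lam g * lam γ * lam g⁻¹ * lam γ⁻¹ = (lam g * lam g⁻¹) * (lam γ * lam γ⁻¹) := by ring
        _ = 1 := by rw [hinv, hinv, one_mul]
    have hd : (1 - lam γ) ≠ 0 := fun h => hγ (by linarith)
    refine affine_of_cocycle lam (fun g => ι ⟨_, hcm g⟩ / (1 - lam γ)) hpos hmul ?_ ?_
    · intro g h
      have e : (⟨_, hcm (g * h)⟩ : C) =
          ⟨g * (h * γ * h⁻¹ * γ⁻¹) * g⁻¹, hC.conj_mem _ (hcm h) g⟩ * ⟨_, hcm g⟩ := by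
        apply Subtype.ext; simp only [Subgroup.coe_mul]; group
      have e2 := hlam g ⟨_, hcm h⟩
      simp only at e2
      rw [e, hι, e2]; ring
    · intro g h1 h2
      have hg : g ∈ C := hker g h1
      have h3 : ι ⟨_, hcm g⟩ = 0 := by
        rcases div_eq_zero_iff.mp h2 with h | h
        · exact h
        · exact absurd h hd
      have e : (⟨_, hcm g⟩ : C) = ⟨g, hg⟩ * ⟨γ * (⟨g, hg⟩⁻¹ : C) * γ⁻¹, hC.conj_mem _ (⟨g, hg⟩⁻¹ : C).2 γ⟩ := by
        apply Subtype.ext; simp only [Subgroup.coe_mul, InvMemClass.coe_inv]; group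
      have einv : ι (⟨g, hg⟩⁻¹) = - ι ⟨g, hg⟩ := by
        have := hι ⟨g, hg⟩ (⟨g, hg⟩⁻¹); rw [mul_inv_cancel, ι1] at this; linarith
      rw [e, hι, hlam γ, einv] at h3
      have h4 : ι ⟨g, hg⟩ * (1 - lam γ) = 0 := by linarith
      rcases mul_eq_zero.mp h4 with h | h
      · exact congrArg Subtype.val (hinj _ h)
      · exact absurd h hd

theorem pow_succ_app (f : HomeoI) (n : ℕ) (x : unitInterval) : (f ^ (n + 1)) x = f ((f ^ n) x) := by
  rw [pow_succ']; rfl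

theorem pow_succ_app2 (f : HomeoI) (n : ℕ) (x : unitInterval) : (f ^ (n + 1)) x = (f ^ n) (f x) := by
  rw [pow_succ]; rfl

theorem inv_app_lt (f : HomeoI) (x : unitInterval) : f⁻¹ x < x ↔ x < f x := by
  change f.symm x < x ↔ x < f x
  rw [OrderIso.symm_apply_lt]

theorem lt_inv_app (f : HomeoI) (x : unitInterval) : x < f⁻¹ x ↔ f x < x := by
  change x < f.symm x ↔ f x < x
  rw [OrderIso.lt_symm_apply]

theorem inv_app_eq (f : HomeoI) (x : unitInterval) : f⁻¹ x = x ↔ f x = x := by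
  change f.symm x = x ↔ f x = x
  rw [OrderIso.symm_apply_eq]; exact eq_comm

/-- the supremum of a forward orbit that moves up -/
theorem orbit_sup (f : HomeoI) (x : unitInterval) (hx : x ≤ f x) :
    ∃ L, f L = L ∧ (∀ n : ℕ, (f ^ n) x ≤ L) ∧ ∀ y, (∀ n : ℕ, (f ^ n) x ≤ y) → L ≤ y := by
  refine ⟨⨆ n : ℕ, (f ^ n) x, ?_, fun n => le_iSup (fun n : ℕ => (f ^ n) x) n, fun y h => iSup_le h⟩
  rw [OrderIso.map_iSup]
  apply le_antisymm
  · apply iSup_le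
    intro n
    rw [← pow_succ_app]
    exact le_iSup (fun n : ℕ => (f ^ n) x) (n + 1)
  · apply iSup_le
    intro n
    refine le_trans ?_ (le_iSup (fun n : ℕ => f ((f ^ n) x)) n)
    rw [← pow_succ_app, pow_succ_app2]
    exact (f ^ n).monotone hx

theorem pow_le_fix (f : HomeoI) (x y : unitInterval) (hxy : x ≤ y) (hy : f y ≤ y) (n : ℕ) :
    (f ^ n) x ≤ y := by
  induction n with
  | zero => exact hxy
  | succ n ih => rw [pow_succ_app]; exact (f.monotone ih).trans hy

theorem lt_pow_app (f : HomeoI) (x : unitInterval) (hx : x < f x) (n : ℕ) : x < (f ^ (n + 1)) x := by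
  induction n with
  | zero => simpa using hx
  | succ n ih => rw [pow_succ_app]; exact hx.trans (f.strictMono ih)

theorem le_pow_app (f : HomeoI) (x : unitInterval) (hx : x ≤ f x) (n : ℕ) : x ≤ (f ^ n) x := by
  induction n with
  | zero => exact le_rfl
  | succ n ih => rw [pow_succ_app]; exact hx.trans (f.monotone ih)

theorem fix_between_up (f : HomeoI) (x y : unitInterval) (hxy : x < y) (hx : x < f x) (hy : f y < y) :
    ∃ p, f p = p ∧ x < p ∧ p < y := by
  obtain ⟨L, hL, h1, h2⟩ := orbit_sup f x hx.le
  refine ⟨L, hL, hx.trans_le (by simpa using h1 1), ?_⟩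
  refine lt_of_le_of_ne (h2 y (pow_le_fix f x y hxy.le hy.le)) ?_
  rintro rfl
  exact hy.ne hL

/-- sign of the displacement -/
def sgn (s : Bool) (f : HomeoI) (x : unitInterval) : Prop := if s then x < f x else f x < x

theorem sgn_inv (s : Bool) (f : HomeoI) (x : unitInterval) : sgn s f⁻¹ x ↔ sgn (!s) f x := by
  cases s
  · exact inv_app_lt f x
  · exact lt_inv_app f x

theorem sgn_total (f : HomeoI) (x : unitInterval) (h : f x ≠ x) (s : Bool) : sgn s f x ∨ sgn (!s) f x := by
  rcases lt_or_gt_of_ne h with h | h <;> cases s <;> simp [sgn, h]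

theorem sgn_ne (s : Bool) (f : HomeoI) (x : unitInterval) (h : sgn s f x) : f x ≠ x := by
  cases s
  · exact ne_of_lt h
  · exact ne_of_gt h

theorem fix_between (f : HomeoI) (s : Bool) (x y : unitInterval) (hxy : x < y) (hx : sgn s f x)
    (hy : sgn (!s) f y) : ∃ p, f p = p ∧ x < p ∧ p < y := by
  cases s
  · obtain ⟨p, h, h'⟩ := fix_between_up f⁻¹ x y hxy ((sgn_inv true f x).mpr hx) ((sgn_inv false f y).mpr hy)
    exact ⟨p, (inv_app_eq f p).mp h, h'⟩
  · exact fix_between_up f x y hxy hx hy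

theorem sgn_const (f : HomeoI) (s : Bool) (a b : unitInterval) (h : ∀ z, a < z → z < b → f z ≠ z)
    (x : unitInterval) (hx1 : a < x) (hx2 : x < b) (hs : sgn s f x) :
    ∀ z, a < z → z < b → sgn s f z := by
  intro z h1 h2
  rcases sgn_total f z (h z h1 h2) s with h3 | h3
  · exact h3
  · exfalso
    rcases lt_trichotomy x z with h4 | h4 | h4
    · obtain ⟨p, hp, hp1, hp2⟩ := fix_between f s x z h4 hs h3
      exact h p (hx1.trans hp1) (hp2.trans h2) hp
    · subst h4
      cases s
      · exact absurd hs (not_lt.mpr (le_of_lt h3))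
      · exact absurd hs (not_lt.mpr (le_of_lt h3))
    · obtain ⟨p, hp, hp1, hp2⟩ := fix_between f (!s) z x h4 h3 (by simpa using hs)
      exact h p (h1.trans hp1) (hp2.trans hx2) hp

/-- points leave an interval on which the map moves down -/
theorem exit_down (w : HomeoI) (x y : unitInterval) (hxy : x ≤ y) (h : ∀ z, x ≤ z → z ≤ y → w z < z) :
    ∃ M0 : ℕ, ∀ M, M0 ≤ M → (w ^ M) y < x := by
  by_contra hcon
  push Not at hcon
  have hwy := h y hxy le_rfl
  have hanti : Antitone (fun n : ℕ => (w ^ n) y) := by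
    apply antitone_nat_of_succ_le
    intro n
    rw [pow_succ_app2]
    exact (w ^ n).monotone hwy.le
  have hall : ∀ n : ℕ, x ≤ (w ^ n) y := by
    intro n
    obtain ⟨M, hM, h1⟩ := hcon n
    exact h1.trans (hanti hM)
  set L := ⨅ n : ℕ, (w ^ n) y with hL
  have h1 : x ≤ L := le_iInf hall
  have h2 : L ≤ y := iInf_le (fun n : ℕ => (w ^ n) y) 0
  have h3 : L ≤ w L := by
    rw [hL, OrderIso.map_iInf]
    apply le_iInf
    intro n
    rw [← pow_succ_app]
    exact iInf_le (fun n : ℕ => (w ^ n) y) (n + 1)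
  exact absurd (h L h1 h2) (not_lt.mpr h3)

/-- positivity of the germ at `0` -/
def Pos0 (f : HomeoI) : Prop := ∃ δ : unitInterval, 0 < δ ∧ ∀ x, 0 < x → x < δ → x < f x

theorem Pos0.mul {f g : HomeoI} (hf : Pos0 f) (hg : Pos0 g) : Pos0 (f * g) := by
  obtain ⟨a, ha, hfa⟩ := hf
  obtain ⟨b, hb, hgb⟩ := hg
  refine ⟨min a b, lt_min ha hb, fun x h0 hx => ?_⟩
  have h1 := hfa x h0 (hx.trans_le (min_le_left _ _))
  have h2 := hgb x h0 (hx.trans_le (min_le_right _ _))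
  exact h1.trans (f.strictMono h2)

theorem app_zero (f : HomeoI) : f 0 = 0 := f.map_bot
theorem app_one (f : HomeoI) : f 1 = 1 := f.map_top
theorem app_pos (f : HomeoI) {x : unitInterval} (h : 0 < x) : 0 < f x := by
  rw [← app_zero f]; exact f.strictMono h
theorem app_lt_one (f : HomeoI) {x : unitInterval} (h : x < 1) : f x < 1 := by
  rw [← app_one f]; exact f.strictMono h

theorem Pos0.conj {f : HomeoI} (hf : Pos0 f) (h : HomeoI) : Pos0 (h * f * h⁻¹) := by
  obtain ⟨a, ha, hfa⟩ := hf
  refine ⟨h a, app_pos h ha, fun x h0 hx => ?_⟩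
  have h1 : h⁻¹ x < a := by
    change h.symm x < a
    rw [OrderIso.symm_apply_lt]; exact hx
  have h2 := hfa (h⁻¹ x) (app_pos _ h0) h1
  have h3 := h.strictMono h2
  change h (h.symm x) < _ at h3
  rw [OrderIso.apply_symm_apply] at h3
  exact h3

theorem not_pos0_one : ¬ Pos0 1 := by
  rintro ⟨δ, hδ, h⟩
  obtain ⟨x, h0, h1⟩ := exists_between hδ
  exact lt_irrefl _ (h x h0 h1)

theorem mem_fix_iff (f : HomeoI) (x : unitInterval) :
    x ∈ interiorFixedPts f ↔ f x = x ∧ 0 < x ∧ x < 1 := Iff.rfl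

theorem pos0_total (f : HomeoI) (hfin : (interiorFixedPts f).Finite) : Pos0 f ∨ Pos0 f⁻¹ := by
  have hδ : ∃ δ : unitInterval, 0 < δ ∧ ∀ z, 0 < z → z < δ → f z ≠ z := by
    by_cases hne : (interiorFixedPts f).Nonempty
    · obtain ⟨m, hm, hmin⟩ := Set.exists_min_image _ id hfin hne
      refine ⟨m, hm.2.1, fun z h0 hz he => ?_⟩
      have : m ≤ z := hmin z ⟨he, h0, lt_trans hz hm.2.2⟩
      exact absurd hz (not_lt.mpr this)
    · refine ⟨1, zero_lt_one, fun z h0 hz he => hne ⟨z, he, h0, hz⟩⟩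
  obtain ⟨δ, hδ0, hδ⟩ := hδ
  obtain ⟨x, h0, h1⟩ := exists_between hδ0
  rcases sgn_total f x (hδ x h0 h1) true with h | h
  · exact Or.inl ⟨δ, hδ0, sgn_const f true 0 δ hδ x h0 h1 h⟩
  · refine Or.inr ⟨δ, hδ0, fun z h2 h3 => ?_⟩
    exact (sgn_inv true f z).mpr (sgn_const f false 0 δ hδ x h0 h1 h z h2 h3)

/-- `j` alternating intervals, each containing `m` steps of `G`. -/
def Alt (G : HomeoI) (δ : unitInterval) (w : HomeoI) (m : ℕ) : ℕ → Bool → unitInterval → Prop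
  | 0, _, _ => True
  | j + 1, s, u => ∃ x, u < x ∧ x ≤ (G ^ m) x ∧ (G ^ m) x < δ ∧
      (∀ z, x ≤ z → z ≤ (G ^ m) x → sgn s w z) ∧ Alt G δ w m j (!s) ((G ^ m) x)

theorem Alt.mono {G : HomeoI} {δ : unitInterval} {w : HomeoI} {m j : ℕ} {s : Bool} {u v : unitInterval}
    (h : Alt G δ w m j s u) (hv : v ≤ u) : Alt G δ w m j s v := by
  cases j with
  | zero => trivial
  | succ j => obtain ⟨x, h1, h2⟩ := h; exact ⟨x, hv.trans_lt h1, h2⟩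

theorem Alt.inv {G : HomeoI} {δ : unitInterval} {w : HomeoI} {m j : ℕ} :
    ∀ {s : Bool} {u : unitInterval}, Alt G δ w m j s u → Alt G δ w⁻¹ m j (!s) u := by
  induction j with
  | zero => intros; trivial
  | succ j ih =>
    rintro s u ⟨x, h1, h2, h3, h4, h5⟩
    refine ⟨x, h1, h2, h3, fun z hz1 hz2 => ?_, ih h5⟩
    rw [sgn_inv, Bool.not_not]; exact h4 z hz1 hz2

theorem Alt.pos {G : HomeoI} {δ : unitInterval} {w : HomeoI} {m j : ℕ} {s : Bool}
    (h : Alt G δ w m j s 0) : ∃ u, 0 < u ∧ Alt G δ w m j s u := by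
  cases j with
  | zero => exact ⟨1, zero_lt_one, trivial⟩
  | succ j =>
    obtain ⟨x, h1, h2⟩ := h
    obtain ⟨u, h3, h4⟩ := exists_between h1
    exact ⟨u, h3, x, h4, h2⟩

theorem Alt.transform {G : HomeoI} {δ : unitInterval} {w g : HomeoI} {m : ℕ}
    (hg : ∀ x, 0 < x → x < δ → x < g x ∧ g x ≤ G x) {j : ℕ} :
    ∀ {s : Bool} {u : unitInterval}, Alt G δ w (m + 2) j s u →
      ∃ M0 : ℕ, ∀ M, M0 ≤ M → Alt G δ (g * w ^ M) m j s u := by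
  induction j with
  | zero => intros; exact ⟨0, fun _ _ => trivial⟩
  | succ j ih =>
    rintro s u ⟨x, h1, h2, h3, h4, h5⟩
    obtain ⟨M1, hM1⟩ := ih h5
    have hx0 : 0 < x := lt_of_le_of_lt unitInterval.nonneg' h1
    have hxδ : x < δ := h2.trans_lt h3
    have hGx : x < G x := (hg x hx0 hxδ).1.trans_le (hg x hx0 hxδ).2
    have e1 : (G ^ m) (G x) ≤ (G ^ (m + 2)) x := by
      rw [← pow_succ_app2, pow_succ_app2 G (m + 1)]
      exact (G ^ (m + 1)).monotone hGx.le
    have e2 : G x ≤ (G ^ m) (G x) := le_pow_app G _ (G.monotone hGx.le) m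
    have hsg : ∃ M2 : ℕ, ∀ M, M2 ≤ M → ∀ z, G x ≤ z → z ≤ (G ^ m) (G x) → sgn s (g * w ^ M) z := by
      cases s
      · obtain ⟨M2, hM2⟩ := exit_down w x ((G ^ (m + 2)) x) h2 h4
        refine ⟨M2, fun M hM z hz1 hz2 => ?_⟩
        have := hM2 M hM
        calc g ((w ^ M) z) ≤ g ((w ^ M) ((G ^ (m + 2)) x)) := g.monotone ((w ^ M).monotone (hz2.trans e1))
          _ < g x := g.strictMono this
          _ ≤ G x := (hg x hx0 hxδ).2
          _ ≤ z := hz1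
      · refine ⟨1, fun M hM z hz1 hz2 => ?_⟩
        obtain ⟨k, rfl⟩ : ∃ k, M = k + 1 := ⟨M - 1, by omega⟩
        have hz0 : 0 < z := hx0.trans (hGx.trans_le hz1)
        have hw := lt_pow_app w z (h4 z (hGx.le.trans hz1) (hz2.trans e1)) k
        exact (hg z hz0 ((hz2.trans e1).trans_lt h3)).1.trans (g.strictMono hw)
    obtain ⟨M2, hM2⟩ := hsg
    refine ⟨max M1 M2, fun M hM => ⟨G x, h1.trans hGx, e2, e1.trans_lt h3,
      hM2 M ((le_max_right _ _).trans hM), ?_⟩⟩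
    exact (hM1 M ((le_max_left _ _).trans hM)).mono e1

/-- one step: add a new alternating interval near zero. -/
theorem Alt.step {G : HomeoI} {δ : unitInterval} {w g : HomeoI} {m : ℕ} (hδ : 0 < δ)
    (hg : ∀ x, 0 < x → x < δ → x < g x ∧ g x ≤ G x) {j : ℕ}
    (h : Alt G δ w (m + 2) j false 0) (hpos : ∀ M : ℕ, Pos0 (g * w ^ M)) :
    ∃ M : ℕ, Alt G δ (g * w ^ M) m (j + 1) true 0 := by
  obtain ⟨u, hu, h⟩ := h.pos
  obtain ⟨M, hM⟩ := h.transform hg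
  obtain ⟨ε, hε, hv⟩ := hpos M
  refine ⟨M, ?_⟩
  have hη : 0 < min (min δ ε) u := lt_min (lt_min hδ hε) hu
  obtain ⟨y, hy0, hy⟩ := exists_between hη
  have hyδ : y < δ := hy.trans_le ((min_le_left _ _).trans (min_le_left _ _))
  have hyε : y < ε := hy.trans_le ((min_le_left _ _).trans (min_le_right _ _))
  have hyu : y < u := hy.trans_le (min_le_right _ _)
  have e : (G ^ m) ((G ^ m)⁻¹ y) = y := (G ^ m).apply_symm_apply y
  have hle : (G ^ m)⁻¹ y ≤ y := by
    change (G ^ m).symm y ≤ y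
    rw [OrderIso.symm_apply_le]
    exact le_pow_app G y ((hg y hy0 hyδ).1.le.trans (hg y hy0 hyδ).2) m
  have hp : 0 < (G ^ m)⁻¹ y := app_pos _ hy0
  refine ⟨(G ^ m)⁻¹ y, hp, ?_, ?_, ?_, ?_⟩
  · rw [e]; exact hle
  · rw [e]; exact hyδ
  · rw [e]; intro z h1 h2
    exact hv z (hp.trans_le h1) (h2.trans_lt hyε)
  · rw [e]; exact (hM M le_rfl).mono hyu.le

theorem Alt.count {G : HomeoI} {δ : unitInterval} {w : HomeoI} {m j : ℕ} :
    ∀ {s : Bool} {u : unitInterval}, Alt G δ w m (j + 1) s u → ∃ x, u < x ∧ sgn s w x ∧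
      ∃ F : Finset unitInterval, F.card = j ∧ ∀ p ∈ F, w p = p ∧ x < p ∧ p < 1 := by
  induction j with
  | zero =>
    rintro s u ⟨x, h1, h2, h3, h4, h5⟩
    exact ⟨x, h1, h4 x le_rfl h2, ∅, rfl, by simp⟩
  | succ j ih =>
    rintro s u ⟨x, h1, h2, h3, h4, h5⟩
    obtain ⟨x', hx', hs', F, hF, hFp⟩ := ih h5
    obtain ⟨p, hp, hp1, hp2⟩ := fix_between w s x x' (h2.trans_lt hx') (h4 x le_rfl h2) hs'
    refine ⟨x, h1, h4 x le_rfl h2, insert p F, ?_, ?_⟩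
    · rw [Finset.card_insert_of_notMem, hF]
      intro hmem
      exact absurd hp2 (not_lt.mpr (hFp p hmem).2.1.le)
    · intro q hq
      rcases Finset.mem_insert.mp hq with rfl | hq
      · exact ⟨hp, hp1, hp2.trans_le unitInterval.le_one'⟩
      · exact ⟨(hFp q hq).1, (h2.trans_lt hx').trans (hFp q hq).2.1, (hFp q hq).2.2⟩

theorem min_fixed (A : Set unitInterval) (hA : A.Finite) (hne : A.Nonempty) :
    ∃ m ∈ A, ∀ f : HomeoI, (∀ x ∈ A, f x ∈ A) → (∀ x ∈ A, f⁻¹ x ∈ A) → f m = m := by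
  obtain ⟨m, hm, hmin⟩ := Set.exists_min_image _ id hA hne
  refine ⟨m, hm, fun f h1 h2 => le_antisymm ?_ (hmin _ (h1 m hm))⟩
  have : m ≤ f⁻¹ m := hmin _ (h2 m hm)
  change m ≤ f.symm m at this
  rwa [OrderIso.le_symm_apply] at this

/-- the order of `Γ` given by the germs at `0` -/
def germOrder (Γ : Subgroup HomeoI)
    (hfin : ∀ f ∈ Γ, f ≠ 1 → (interiorFixedPts f).Finite) : LinearOrder Γ where
  le a b := a = b ∨ Pos0 ((a⁻¹ * b : Γ) : HomeoI)
  lt a b := Pos0 ((a⁻¹ * b : Γ) : HomeoI)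
  le_refl a := Or.inl rfl
  le_trans a b c hab hbc := by
    rcases hab with rfl | hab
    · exact hbc
    rcases hbc with rfl | hbc
    · exact Or.inr hab
    right
    have := hab.mul hbc
    have e : (a⁻¹ * c : Γ) = (a⁻¹ * b) * (b⁻¹ * c) := by group
    rw [e]; exact this
  lt_iff_le_not_ge a b := by
    constructor
    · intro h
      refine ⟨Or.inr h, ?_⟩
      rintro (rfl | h2)
      · rw [inv_mul_cancel] at h; exact not_pos0_one h
      · have := h.mul h2
        have e : (1 : Γ) = (a⁻¹ * b) * (b⁻¹ * a) := by group
        apply not_pos0_one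
        rw [← Subgroup.coe_one Γ, e]; exact this
    · rintro ⟨rfl | h1, h2⟩
      · exact absurd (Or.inl rfl) h2
      · exact h1
  le_antisymm a b hab hba := by
    rcases hab with rfl | hab
    · rfl
    rcases hba with rfl | hba
    · rfl
    exfalso
    have := hab.mul hba
    have e : (1 : Γ) = (a⁻¹ * b) * (b⁻¹ * a) := by group
    apply not_pos0_one
    rw [← Subgroup.coe_one Γ, e]; exact this
  le_total a b := by
    by_cases hab : a = b
    · exact Or.inl (Or.inl hab)
    have h1 : ((a⁻¹ * b : Γ) : HomeoI) ≠ 1 := by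
      intro h
      have : (a⁻¹ * b : Γ) = 1 := Subtype.ext h
      exact hab (inv_mul_eq_one.mp this)
    rcases pos0_total _ (hfin _ (a⁻¹ * b : Γ).2 h1) with h | h
    · exact Or.inl (Or.inr h)
    · right; right
      have e : (b⁻¹ * a : Γ) = (a⁻¹ * b)⁻¹ := by group
      rw [e]; exact h
  toDecidableLE := Classical.decRel _

section
variable {Γ : Subgroup HomeoI} [LinearOrder Γ] [MulLeftMono Γ] [MulRightMono Γ]

theorem lt_app_near (hlt : ∀ a : Γ, 1 < a ↔ Pos0 (a : HomeoI)) (a b : Γ) (hab : a < b) :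
    ∃ δ : unitInterval, 0 < δ ∧ ∀ x, 0 < x → x < δ → (a : HomeoI) x < (b : HomeoI) x := by
  have h1 : 1 < a⁻¹ * b := by rw [lt_inv_mul_iff_mul_lt, mul_one]; exact hab
  obtain ⟨δ, hδ, h⟩ := (hlt _).mp h1
  refine ⟨δ, hδ, fun x h0 hx => ?_⟩
  have := h x h0 hx
  change x < (a : HomeoI).symm ((b : HomeoI) x) at this
  rwa [OrderIso.lt_symm_apply] at this

theorem zpow_dom (a b : Γ) (ha : 1 < a) (h : ∀ n : ℕ, a ^ n < b) (n : ℤ) : a ^ n < b := by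
  obtain ⟨k, rfl | rfl⟩ := n.eq_nat_or_neg
  · rw [zpow_natCast]; exact h k
  · rw [zpow_neg, zpow_natCast]
    have h1 : (a ^ k)⁻¹ ≤ 1 := inv_le_one'.mpr (one_le_pow_of_one_le' ha.le k)
    refine h1.trans_lt ?_
    simpa using h 0

theorem exists_min_class (N : ℕ) (hlt : ∀ a : Γ, 1 < a ↔ Pos0 (a : HomeoI))
    (hfix : ∀ f ∈ Γ, f ≠ 1 → (interiorFixedPts f).encard ≤ (N : ℕ∞))
    (h0 : ∃ h : Γ, 1 < h) : ∃ h : Γ, 1 < h ∧ ∀ g : Γ, 1 < g → ∃ n : ℕ, h ≤ g ^ n := by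
  by_contra hcon
  push Not at hcon
  have hcon' : ∀ h : {h : Γ // 1 < h}, ∃ g : {h : Γ // 1 < h}, ∀ n : ℕ, g.1 ^ n < h.1 := by
    rintro ⟨h, hh⟩
    obtain ⟨g, hg, hgn⟩ := hcon h hh
    exact ⟨⟨g, hg⟩, hgn⟩
  choose Φ hΦ using hcon'
  obtain ⟨h0, hh0⟩ := h0
  let a : ℕ → {h : Γ // 1 < h} := fun n => Φ^[n] ⟨h0, hh0⟩
  have ha : ∀ n (k : ℕ), (a (n + 1)).1 ^ k < (a n).1 := by
    intro n k
    have : a (n + 1) = Φ (a n) := Function.iterate_succ_apply' Φ n _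
    rw [this]; exact hΦ _ k
  have hle : ∀ n, (a n).1 ≤ (a 0).1 := by
    intro n
    induction n with
    | zero => exact le_rfl
    | succ n ih =>
      refine le_trans ?_ ih
      have := ha n 1
      rw [pow_one] at this; exact this.le
  have hδ : ∀ k : ℕ, ∃ δ : unitInterval, 0 < δ ∧ ∀ i, i ≤ k → ∀ x, 0 < x → x < δ →
      x < ((a i).1 : HomeoI) x ∧ ((a i).1 : HomeoI) x ≤ ((a 0).1 : HomeoI) x := by
    have one : ∀ i : ℕ, ∃ δ : unitInterval, 0 < δ ∧ ∀ x, 0 < x → x < δ →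
      x < ((a i).1 : HomeoI) x ∧ ((a i).1 : HomeoI) x ≤ ((a 0).1 : HomeoI) x := by
      intro i
      obtain ⟨d1, hd1, h1⟩ := (hlt _).mp (a i).2
      rcases (hle i).eq_or_lt with h | h
      · exact ⟨d1, hd1, fun x hx0 hx => ⟨h1 x hx0 hx, by rw [h]⟩⟩
      · obtain ⟨d2, hd2, h2⟩ := lt_app_near hlt _ _ h
        exact ⟨min d1 d2, lt_min hd1 hd2, fun x hx0 hx => ⟨h1 x hx0 (hx.trans_le (min_le_left _ _)),
          (h2 x hx0 (hx.trans_le (min_le_right _ _))).le⟩⟩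
    intro k
    induction k with
    | zero =>
      obtain ⟨d, hd, h⟩ := one 0
      refine ⟨d, hd, fun i hi => ?_⟩
      obtain rfl : i = 0 := by omega
      exact h
    | succ k ih =>
      obtain ⟨d, hd, h⟩ := ih
      obtain ⟨d', hd', h'⟩ := one (k + 1)
      refine ⟨min d d', lt_min hd hd', fun i hi x hx0 hx => ?_⟩
      rcases Nat.lt_or_ge i (k + 1) with hi' | hi'
      · exact h i (by omega) x hx0 (hx.trans_le (min_le_left _ _))
      · obtain rfl : i = k + 1 := by omega
        exact h' x hx0 (hx.trans_le (min_le_right _ _))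
  obtain ⟨δ, hδ0, hδ⟩ := hδ (N + 2)
  set G : HomeoI := ((a 0).1 : HomeoI) with hG
  have main : ∀ j, j ≤ N + 2 → ∀ m : ℕ, ∃ w : Γ, Alt G δ (w : HomeoI) m j false 0 ∧
      ∀ n : ℤ, w ^ n < (a (N + 2 - j)).1 := by
    intro j
    induction j with
    | zero =>
      intro _ m
      refine ⟨1, trivial, fun n => ?_⟩
      rw [one_zpow]; exact (a _).2
    | succ j ih =>
      intro hj m
      obtain ⟨w, hw, hdom⟩ := ih (by omega) (m + 2)
      set g := (a (N + 2 - j)).1 with hgdef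
      have hpos : ∀ M : ℕ, 1 < g * w ^ M := by
        intro M
        have := hdom (-(M : ℤ))
        rw [zpow_neg, zpow_natCast] at this
        exact inv_lt_iff_one_lt_mul.mp this
      obtain ⟨M, hM⟩ := Alt.step (g := (g : HomeoI)) hδ0 (hδ (N + 2 - j) (by omega)) hw
        (fun M => by have := (hlt _).mp (hpos M); simpa using this)
      refine ⟨(g * w ^ M)⁻¹, ?_, ?_⟩
      · have := hM.inv
        simpa using this
      · have hg1 : 1 < g := (a _).2
        have hv : g * w ^ M ≤ g ^ 2 := by
          rw [pow_two]
          refine mul_le_mul_right ?_ g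
          have := hdom M
          rw [zpow_natCast] at this; exact this.le
        have e : N + 2 - j = (N + 2 - (j + 1)) + 1 := by omega
        have hnat : ∀ n : ℕ, (g * w ^ M) ^ n < (a (N + 2 - (j + 1))).1 := by
          intro n
          calc (g * w ^ M) ^ n ≤ (g ^ 2) ^ n := pow_le_pow_left' hv n
            _ = g ^ (2 * n) := by rw [pow_mul]
            _ < _ := by rw [hgdef, e]; exact ha _ _
        intro n
        rw [inv_zpow']
        exact zpow_dom _ _ (hpos M) hnat (-n)
  obtain ⟨w, hw, -⟩ := main (N + 2) le_rfl 0
  obtain ⟨x, hx0, hsx, F, hF, hFp⟩ := Alt.count hw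
  have hw1 : (w : HomeoI) ≠ 1 := by
    intro h
    apply sgn_ne _ _ _ hsx
    rw [h]; rfl
  have h1 := hfix w w.2 hw1
  have h2 : (F : Set unitInterval) ⊆ interiorFixedPts (w : HomeoI) := by
    intro p hp
    obtain ⟨e1, e2, e3⟩ := hFp p hp
    exact ⟨e1, lt_trans hx0 e2, e3⟩
  have h3 := (Set.encard_le_encard h2).trans h1
  rw [Set.encard_coe_eq_coe_finsetCard, hF] at h3
  have h4 : N + 1 ≤ N := by exact_mod_cast h3
  omega

/-- an element of `Γ` without interior fixed points and positive at `0` is positive everywhere -/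
theorem pos_everywhere (f : HomeoI) (hf : Pos0 f) (hfree : ∀ z, 0 < z → z < 1 → f z ≠ z) :
    ∀ z, 0 < z → z < 1 → z < f z := by
  obtain ⟨δ, hδ, h⟩ := hf
  obtain ⟨x, hx0, hx⟩ := exists_between hδ
  exact sgn_const f true 0 1 hfree x hx0 (hx.trans_le unitInterval.le_one') (h x hx0 hx)

/-- commuting maps preserve the fixed point set -/
theorem comm_fix (c t : HomeoI) (h : c * t = t * c) (x : unitInterval) (hx : x ∈ interiorFixedPts c) :
    t x ∈ interiorFixedPts c := by
  refine ⟨?_, app_pos t hx.2.1, app_lt_one t hx.2.2⟩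
  have := congrArg (fun f : HomeoI => f x) h
  change c (t x) = t (c x) at this
  rw [this, hx.1]

theorem comm_min (c : HomeoI) (hfin : (interiorFixedPts c).Finite) (hne : (interiorFixedPts c).Nonempty) :
    ∃ p, 0 < p ∧ p < 1 ∧ c p = p ∧ ∀ t : HomeoI, c * t = t * c → t p = p := by
  obtain ⟨p, hp, h⟩ := min_fixed _ hfin hne
  refine ⟨p, hp.2.1, hp.2.2, hp.1, fun t ht => h t (comm_fix c t ht) (comm_fix c t⁻¹ ?_)⟩
  exact (Commute.inv_right (show Commute c t from ht))

theorem affine_main (N : ℕ) (hlt : ∀ a : Γ, 1 < a ↔ Pos0 (a : HomeoI))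
    (hirr : IrreducibleSubgroup Γ)
    (hfix : ∀ f ∈ Γ, f ≠ 1 → (interiorFixedPts f).encard ≤ (N : ℕ∞)) :
    ∃ φ : Γ →* (ℝ ≃o ℝ), Function.Injective φ ∧
      ∀ γ, ∃ a b : ℝ, 0 < a ∧ ∀ x : ℝ, φ γ x = a * x + b := by
  have hfin : ∀ f : Γ, f ≠ 1 → (interiorFixedPts (f : HomeoI)).Finite := by
    intro f hf
    apply Set.finite_of_encard_le_coe (hfix f f.2 ?_)
    exact fun h => hf (Subtype.ext h)
  obtain ⟨hp, hp0, hp1⟩ : ∃ hp : unitInterval, 0 < hp ∧ hp < 1 := exists_between zero_lt_one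
  have hex : ∃ h : Γ, 1 < h := by
    obtain ⟨f, hf, hne⟩ := hirr hp hp0 hp1
    have : (⟨f, hf⟩ : Γ) ≠ 1 := by
      intro h
      have : f = 1 := congrArg Subtype.val h
      rw [this] at hne; exact hne rfl
    rcases lt_or_gt_of_ne this with h | h
    · exact ⟨_, one_lt_inv'.mpr h⟩
    · exact ⟨_, h⟩
  obtain ⟨h, h1, hmin⟩ := exists_min_class N hlt hfix hex
  -- the minimal convex subgroup
  let T : Subgroup Γ :=
    { carrier := {x | ∃ n : ℕ, x ≤ h ^ n ∧ x⁻¹ ≤ h ^ n}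
      one_mem' := ⟨0, by simp⟩
      mul_mem' := by
        rintro a b ⟨n, hn1, hn2⟩ ⟨m, hm1, hm2⟩
        refine ⟨n + m, ?_, ?_⟩
        · rw [pow_add]; exact mul_le_mul' hn1 hm1
        · rw [mul_inv_rev, add_comm, pow_add]; exact mul_le_mul' hm2 hn2
      inv_mem' := by
        rintro a ⟨n, hn1, hn2⟩
        exact ⟨n, hn2, by rwa [inv_inv]⟩ }
  have hTh : h ∈ T := by
    refine ⟨1, by simp, ?_⟩
    rw [pow_one]
    exact (inv_lt_one'.mpr h1).le.trans h1.le
  have conj_le : ∀ y a b : Γ, a ≤ b → y * a * y⁻¹ ≤ y * b * y⁻¹ := fun y a b hab =>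
    mul_le_mul_left (mul_le_mul_right hab y) _
  have conj_lt : ∀ y a b : Γ, a < b → y * a * y⁻¹ < y * b * y⁻¹ := fun y a b hab =>
    lt_of_le_of_ne (conj_le y a b hab.le) (fun e => hab.ne (by simpa using e))
  have hTn : T.Normal := by
    constructor
    rintro x ⟨n, hn1, hn2⟩ y
    have h2 : 1 < y⁻¹ * h * y⁻¹⁻¹ := by
      have := conj_lt y⁻¹ 1 h h1
      simpa using this
    obtain ⟨k, hk⟩ := hmin _ h2
    rw [conj_pow] at hk
    have hk' : y * h * y⁻¹ ≤ h ^ k := by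
      have := conj_le y _ _ hk
      simpa [mul_assoc] using this
    have key : ∀ z : Γ, z ≤ h ^ n → y * z * y⁻¹ ≤ h ^ (k * n) := by
      intro z hz
      calc y * z * y⁻¹ ≤ y * h ^ n * y⁻¹ := conj_le y _ _ hz
        _ = (y * h * y⁻¹) ^ n := by rw [conj_pow]
        _ ≤ (h ^ k) ^ n := pow_le_pow_left' hk' n
        _ = h ^ (k * n) := by rw [pow_mul]
    refine ⟨k * n, key x hn1, ?_⟩
    have e : (y * x * y⁻¹)⁻¹ = y * x⁻¹ * y⁻¹ := by group
    rw [e]; exact key _ hn2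
  have lm : ∀ S : Subgroup Γ, MulLeftMono S := fun S => ⟨fun a b c hbc =>
    show (a : Γ) * b ≤ a * c from mul_le_mul_right (show (b : Γ) ≤ c from hbc) _⟩
  have rm : ∀ S : Subgroup Γ, MulRightMono S := fun S => ⟨fun a b c hbc =>
    show (b : Γ) * a ≤ c * a from mul_le_mul_left (show (b : Γ) ≤ c from hbc) _⟩
  have := lm T
  have := rm T
  have hTcomm : ∀ a b : T, a * b = b * a := by
    apply holder_comm
    rintro ⟨a, ha⟩ ⟨b, m, hb, hb'⟩ ha1
    obtain ⟨n, hn⟩ := hmin a ha1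
    refine ⟨n * m, ?_⟩
    change b ≤ a ^ (n * m)
    rw [pow_mul]
    exact hb.trans (pow_le_pow_left' hn m)
  -- `T` acts freely
  have hTfree : ∀ t ∈ T, t ≠ 1 → ∀ z, 0 < z → z < 1 → (t : HomeoI) z ≠ z := by
    intro t ht ht1 z hz0 hz1 htz
    obtain ⟨p, hp0, hp1, -, hp⟩ := comm_min (t : HomeoI) (hfin t ht1) ⟨z, htz, hz0, hz1⟩
    let A : Set unitInterval := {x | 0 < x ∧ x < 1 ∧ ∀ s ∈ T, (s : HomeoI) x = x}
    have hAne : A.Nonempty := by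
      refine ⟨p, hp0, hp1, fun s hs => hp s ?_⟩
      have := hTcomm ⟨t, ht⟩ ⟨s, hs⟩
      have h2 : t * s = s * t := congrArg Subtype.val this
      exact congrArg Subtype.val h2
    have hAfin : A.Finite := (hfin t ht1).subset fun x hx => ⟨hx.2.2 t ht, hx.1, hx.2.1⟩
    obtain ⟨q, hq, hqf⟩ := min_fixed A hAfin hAne
    have hinv : ∀ f : Γ, ∀ x ∈ A, (f : HomeoI) x ∈ A := by
      rintro f x ⟨hx0, hx1, hx⟩
      refine ⟨app_pos _ hx0, app_lt_one _ hx1, fun s hs => ?_⟩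
      have h2 := hx _ (hTn.conj_mem s hs f⁻¹)
      have h3 : (s : HomeoI) ((f : HomeoI) x)
          = (f : HomeoI) (((f⁻¹ * s * f⁻¹⁻¹ : Γ) : HomeoI) x) := by
        have e : s * f = f * (f⁻¹ * s * f⁻¹⁻¹) := by group
        exact congrArg (fun g : Γ => (g : HomeoI) x) e
      rw [h3, h2]
    obtain ⟨f, hf, hne⟩ := hirr q hq.1 hq.2.1
    exact hne (hqf f (hinv ⟨f, hf⟩) (hinv ⟨f, hf⟩⁻¹))
  -- the centralizer acts freely
  let C : Subgroup Γ := Subgroup.centralizer (T : Set Γ)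
  have hCn : C.Normal := Subgroup.normal_centralizer
  have hCmem : ∀ c : Γ, c ∈ C ↔ ∀ t ∈ T, t * c = c * t := fun c => Subgroup.mem_centralizer_iff
  have hTC : ∀ t ∈ T, t ∈ C := by
    intro t ht
    rw [hCmem]
    intro s hs
    exact congrArg Subtype.val (hTcomm ⟨s, hs⟩ ⟨t, ht⟩)
  have hCfree : ∀ c ∈ C, c ≠ 1 → ∀ z, 0 < z → z < 1 → (c : HomeoI) z ≠ z := by
    intro c hc hc1 z hz0 hz1 hcz
    obtain ⟨p, hp0, hp1, -, hp⟩ := comm_min (c : HomeoI) (hfin c hc1) ⟨z, hcz, hz0, hz1⟩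
    refine hTfree h hTh h1.ne' p hp0 hp1 (hp h ?_)
    exact congrArg Subtype.val ((hCmem c).mp hc h hTh).symm
  have := lm C
  have := rm C
  have hCarch : ∀ a b : C, 1 < a → ∃ n : ℕ, b ≤ a ^ n := by
    intro a b ha
    have ha' : 1 < (a : Γ) := ha
    have hup := pos_everywhere _ ((hlt _).mp ha') (hCfree a a.2 ha'.ne')
    obtain ⟨L, hL, hL1, hL2⟩ := orbit_sup ((a : Γ) : HomeoI) hp (hup hp hp0 hp1).le
    have hL1' : L = 1 := by
      by_contra hne
      have hlt1 : L < 1 := lt_of_le_of_ne unitInterval.le_one' hne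
      have hL0 : 0 < L := hp0.trans_le (hL1 0)
      exact (hup L hL0 hlt1).ne' hL
    have hn : ∃ n : ℕ, ((b : Γ) : HomeoI) hp < (((a : Γ) : HomeoI) ^ n) hp := by
      by_contra hcon
      push Not at hcon
      have := hL2 _ hcon
      rw [hL1'] at this
      exact absurd (app_lt_one ((b : Γ) : HomeoI) hp1) (not_lt.mpr this)
    obtain ⟨n, hn⟩ := hn
    refine ⟨n, ?_⟩
    by_contra hcon
    push Not at hcon
    have hgt : (a : Γ) ^ n < b := hcon
    have h2 : 1 < ((a : Γ) ^ n)⁻¹ * b := by rw [lt_inv_mul_iff_mul_lt, mul_one]; exact hgt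
    have hmem : ((a : Γ) ^ n)⁻¹ * b ∈ C := C.mul_mem (C.inv_mem (C.pow_mem a.2 n)) b.2
    have h3 := pos_everywhere _ ((hlt _).mp h2) (hCfree _ hmem h2.ne') hp hp0 hp1
    have h4 : hp < (((a : Γ) : HomeoI) ^ n).symm (((b : Γ) : HomeoI) hp) := h3
    rw [OrderIso.lt_symm_apply] at h4
    exact absurd hn (not_lt.mpr h4.le)
  obtain ⟨ι, hι, hι'⟩ := holder_embed hCarch
  have ι1 : ι 1 = 0 := by have := hι 1 1; rw [mul_one] at this; linarith
  let cj : Γ → C → C := fun g c => ⟨g * c * g⁻¹, hCn.conj_mem c c.2 g⟩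
  let h' : C := ⟨h, hTC h hTh⟩
  have hh' : 1 < h' := h1
  have hcjpos : ∀ g, 1 < cj g h' := by
    intro g
    change 1 < g * h * g⁻¹
    have := conj_lt g 1 h h1
    simpa using this
  have hpos' : ∀ c, 1 < c → 0 < ι c := fun c hc => by have := hι' 1 c hc; rwa [ι1] at this
  have hinj : ∀ c, ι c = 0 → c = 1 := by
    intro c hc
    rcases lt_trichotomy c 1 with h | h | h
    · have := hι' _ _ h; rw [ι1, hc] at this; exact absurd this (lt_irrefl _)
    · exact h
    · have := hι' _ _ h; rw [ι1, hc] at this; exact absurd this (lt_irrefl _)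
  have hlam : ∀ g (c : C), ι (cj g c) = ι (cj g h') / ι h' * ι c := by
    intro g c
    refine scale_unique ι (fun c => ι (cj g c)) hι hι' ?_ ?_ h' hh' c
    · intro a b
      have e : cj g (a * b) = cj g a * cj g b := by
        apply Subtype.ext
        change g * ((a : Γ) * b) * g⁻¹ = g * a * g⁻¹ * (g * b * g⁻¹)
        group
      change ι (cj g (a * b)) = _
      rw [e, hι]
    · intro a b hab
      exact hι' _ _ (conj_lt g a b hab)
  refine affine_of_normal C ι hι hinj ⟨h', hh'.ne'⟩ (fun g => ι (cj g h') / ι h')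
    (fun g => div_pos (hpos' _ (hcjpos g)) (hpos' _ hh')) hlam ?_
  intro g hg
  rw [hCmem]
  intro t ht
  have h2 := hlam g ⟨t, hTC t ht⟩
  have hg' : ι (cj g h') / ι h' = 1 := hg
  rw [hg', one_mul] at h2
  have hιinj : ∀ a b : C, ι a = ι b → a = b := by
    intro a b hab
    rcases lt_trichotomy a b with h | h | h
    · exact absurd hab (hι' _ _ h).ne
    · exact h
    · exact absurd hab (hι' _ _ h).ne'
  have h3 : g * t * g⁻¹ = t := congrArg Subtype.val (hιinj _ _ h2)
  rw [mul_inv_eq_iff_eq_mul] at h3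
  exact h3.symm

end

/-- Let `N ≥ 0` and let `Γ` be an irreducible subgroup of `Diff₊(I)`
such that every non-identity element of `Γ` has at most `N` fixed points in `(0,1)`.
Then `Γ` is isomorphic to a subgroup of `Aff₊(ℝ)`. -/
theorem irreducible_boundedFixedPoints_isomorphic_affine
    (N : ℕ) (Γ : Subgroup HomeoI)
    (hdiff : ∀ f ∈ Γ, IsC1DiffeoI f)
    (hirr : IrreducibleSubgroup Γ)
    (hfix : ∀ f ∈ Γ, f ≠ 1 → (interiorFixedPts f).encard ≤ (N : ℕ∞)) :
    IsIsomorphicToAffineSubgroup Γ := by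
  have hfin : ∀ f ∈ Γ, f ≠ 1 → (interiorFixedPts f).Finite := fun f hf hne =>
    Set.finite_of_encard_le_coe (hfix f hf hne)
  let _ : LinearOrder Γ := germOrder Γ hfin
  have hltdef : ∀ a b : Γ, a < b ↔ Pos0 ((a⁻¹ * b : Γ) : HomeoI) := fun a b => Iff.rfl
  have hledef : ∀ a b : Γ, a ≤ b ↔ (a = b ∨ Pos0 ((a⁻¹ * b : Γ) : HomeoI)) := fun a b => Iff.rfl
  have : MulLeftMono Γ := by
    constructor
    intro c a b hab
    change c * a ≤ c * b
    rw [hledef] at hab ⊢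
    rcases hab with rfl | hab
    · exact Or.inl rfl
    · right
      have e : (c * a)⁻¹ * (c * b) = a⁻¹ * b := by group
      rw [e]; exact hab
  have : MulRightMono Γ := by
    constructor
    intro c a b hab
    change a * c ≤ b * c
    rw [hledef] at hab ⊢
    rcases hab with rfl | hab
    · exact Or.inl rfl
    · right
      have e : (a * c)⁻¹ * (b * c) = c⁻¹ * (a⁻¹ * b) * c⁻¹⁻¹ := by group
      rw [e]; exact hab.conj _
  have hlt : ∀ a : Γ, 1 < a ↔ Pos0 (a : HomeoI) := by
    intro a
    rw [hltdef, inv_one, one_mul]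
  exact affine_main N hlt hirr hfix

end
end

section
/- Let N ≥ 2 and let Γ be an irreducible subgroup of Diff₊(I) such that every non-identity element of Γ has at most N fixed points in the open interval (0,1). Then in fact every non-identity element of Γ has at most 1 fixed point in (0,1). -/
open Set

noncomputable section

namespace Prf

open Filter Topology

abbrev I := ↥unitInterval

def Alt (m : ℕ) (g : HomeoI) (x : ℕ → I) : Prop :=
  (∀ i < m, x i < x (i+1)) ∧
    ∀ i ≤ m, (Even i → x i < g (x i)) ∧ (¬ Even i → g (x i) < x i)

lemma mul_app (f g : HomeoI) (x : I) : (f * g) x = f (g x) := rfl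

lemma inv_app (f : HomeoI) (x : I) : f⁻¹ (f x) = x := f.symm_apply_apply x

lemma app_inv (f : HomeoI) (x : I) : f (f⁻¹ x) = x := f.apply_symm_apply x

lemma pow_succ_app (f : HomeoI) (n : ℕ) (x : I) : (f ^ (n+1)) x = f ((f ^ n) x) := by
  rw [pow_succ']; rfl

lemma pow_succ_app' (f : HomeoI) (n : ℕ) (x : I) : (f ^ (n+1)) x = (f ^ n) (f x) := by
  rw [pow_succ]; rfl

lemma cont (f : HomeoI) : Continuous f := f.continuous

lemma app_zero (f : HomeoI) : f 0 = 0 := f.map_bot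

lemma app_one (f : HomeoI) : f 1 = 1 := f.map_top

lemma app_pos (f : HomeoI) {x : I} (h : 0 < x) : 0 < f x := by
  rw [← app_zero f]; exact f.lt_iff_lt.2 h

lemma app_lt_one (f : HomeoI) {x : I} (h : x < 1) : f x < 1 := by
  rw [← app_one f]; exact f.lt_iff_lt.2 h

lemma lt_inv_iff (f : HomeoI) (x y : I) : x < f⁻¹ y ↔ f x < y := f.lt_symm_apply

lemma inv_lt_iff (f : HomeoI) (x y : I) : f⁻¹ x < y ↔ x < f y := f.symm_apply_lt

lemma inv_eq_iff (f : HomeoI) (x y : I) : f⁻¹ x = y ↔ x = f y := f.symm_apply_eq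

lemma mem_ifp {f : HomeoI} {x : I} : x ∈ interiorFixedPts f ↔ f x = x ∧ 0 < x ∧ x < 1 := Iff.rfl

/-- intermediate value theorem for fixed points -/
lemma ivt (f : HomeoI) {x y : I} (hxy : x ≤ y) (h : (f x ≤ x ∧ y ≤ f y) ∨ (x ≤ f x ∧ f y ≤ y)) :
    ∃ p, x ≤ p ∧ p ≤ y ∧ f p = p := by
  rcases h with h | h
  · obtain ⟨p, hp, h⟩ := isPreconnected_Icc.intermediate_value₂ (s := Set.Icc x y)
      (left_mem_Icc.2 hxy) (right_mem_Icc.2 hxy) (cont f).continuousOn continuousOn_id h.1 h.2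
    exact ⟨p, hp.1, hp.2, h⟩
  · obtain ⟨p, hp, h⟩ := isPreconnected_Icc.intermediate_value₂ (s := Set.Icc x y)
      (left_mem_Icc.2 hxy) (right_mem_Icc.2 hxy) continuousOn_id (cont f).continuousOn h.1 h.2
    exact ⟨p, hp.1, hp.2, h.symm⟩

/-- constancy of sign, "up" -/
lemma sign_up (f : HomeoI) {S : Set I} (hS : S.OrdConnected) (hf : ∀ x ∈ S, f x ≠ x)
    {x y : I} (hx : x ∈ S) (hy : y ∈ S) (h : x < f x) : y < f y := by
  by_contra hc
  push Not at hc
  rcases le_total x y with hxy | hxy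
  · obtain ⟨p, h1, h2, h3⟩ := ivt f hxy (Or.inr ⟨h.le, hc⟩)
    exact hf p (hS.out hx hy ⟨h1, h2⟩) h3
  · obtain ⟨p, h1, h2, h3⟩ := ivt f hxy (Or.inl ⟨hc, h.le⟩)
    exact hf p (hS.out hy hx ⟨h1, h2⟩) h3

lemma sign_cases (f : HomeoI) {S : Set I} (hS : S.OrdConnected) (hf : ∀ x ∈ S, f x ≠ x) :
    (∀ x ∈ S, x < f x) ∨ (∀ x ∈ S, f x < x) := by
  by_cases h : ∃ x ∈ S, x < f x
  · obtain ⟨x, hx, h⟩ := h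
    exact Or.inl fun y hy => sign_up f hS hf hx hy h
  · push Not at h
    exact Or.inr fun y hy => lt_of_le_of_ne (h y hy) (hf y hy)

lemma alt_encard {m : ℕ} {g : HomeoI} {x : ℕ → I} (h : Alt m g x) :
    (m : ℕ∞) ≤ (interiorFixedPts g).encard := by
  have key : ∀ i : Fin m, ∃ p, x i < p ∧ p < x (i+1) ∧ g p = p := by
    intro i
    have h1 := h.1 i i.2
    have h2 := h.2 i i.2.le
    have h3 := h.2 (i+1) i.2
    have : ∃ p, x i ≤ p ∧ p ≤ x (i+1) ∧ g p = p := by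
      apply ivt g h1.le
      by_cases he : Even (i : ℕ)
      · right
        exact ⟨(h2.1 he).le, (h3.2 (by simpa [Nat.even_add_one] using he)).le⟩
      · left
        exact ⟨(h2.2 he).le, (h3.1 (by simpa [Nat.even_add_one] using he)).le⟩
    obtain ⟨p, a, b, c⟩ := this
    refine ⟨p, lt_of_le_of_ne a ?_, lt_of_le_of_ne b ?_, c⟩
    · rintro hh
      by_cases he : Even (i : ℕ)
      · have := h2.1 he; rw [hh, c] at this; exact lt_irrefl _ this
      · have := h2.2 he; rw [hh, c] at this; exact lt_irrefl _ this
    · rintro hh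
      by_cases he : Even ((i : ℕ) + 1)
      · have := h3.1 he; rw [← hh, c] at this; exact lt_irrefl _ this
      · have := h3.2 he; rw [← hh, c] at this; exact lt_irrefl _ this
  choose p hp1 hp2 hp3 using key
  have hmono : ∀ j : ℕ, j ≤ m → ∀ i ≤ j, x i ≤ x j := by
    intro j
    induction j with
    | zero => intro _ i hi; simp at hi; simp [hi]
    | succ j ih =>
      intro hj i hi
      rcases Nat.lt_or_ge i (j+1) with h' | h'
      · exact (ih (by omega) i (by omega)).trans (h.1 j (by omega)).le
      · have : i = j+1 := by omega
        rw [this]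
  have hinj : Function.Injective p := by
    have : StrictMono p := by
      intro i j hij
      calc p i < x (i+1) := hp2 i
        _ ≤ x j := hmono j j.2.le (i+1) hij
        _ < p j := hp1 j
    exact this.injective
  have hsub : Set.range p ⊆ interiorFixedPts g := by
    rintro _ ⟨i, rfl⟩
    refine mem_ifp.2 ⟨hp3 i, lt_of_le_of_lt ?_ (hp1 i), lt_of_lt_of_le (hp2 i) ?_⟩
    · exact (x i).2.1
    · exact (x (i+1)).2.2
  calc (m : ℕ∞) = (Set.range p).encard := by
        rw [← Set.image_univ, hinj.encard_image]; simp
    _ ≤ _ := Set.encard_le_encard hsub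

lemma iter_down (f : HomeoI) {p q y : I} (hp : f p = p) (hpq : p < q)
    (hf : ∀ x, p < x → x ≤ q → f x < x) (hy : p < y) :
    ∃ n0 : ℕ, ∀ n ≥ n0, p < (f ^ n) q ∧ (f ^ n) q < y ∧ (f ^ n) q ≤ q := by
  have hb : ∀ n : ℕ, p < (f ^ n) q ∧ (f ^ n) q ≤ q := by
    intro n
    induction n with
    | zero => exact ⟨hpq, le_rfl⟩
    | succ n ih =>
      rw [pow_succ_app]
      refine ⟨?_, (hf _ ih.1 ih.2).le.trans ih.2⟩
      conv_lhs => rw [← hp]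
      exact f.lt_iff_lt.2 ih.1
  have hanti : Antitone fun n : ℕ => (f ^ n) q := by
    apply antitone_nat_of_succ_le
    intro n
    rw [pow_succ_app]
    exact (hf _ (hb n).1 (hb n).2).le
  suffices h : ∃ n : ℕ, (f ^ n) q < y by
    obtain ⟨n, hn⟩ := h
    exact ⟨n, fun k hk => ⟨(hb k).1, (hanti hk).trans_lt hn, (hb k).2⟩⟩
  by_contra hc
  push Not at hc
  set S : Set I := Set.range fun n : ℕ => (f ^ n) q with hS
  have hne : (closure S).Nonempty := ⟨q, subset_closure ⟨0, rfl⟩⟩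
  obtain ⟨m, hm, hml⟩ := (isClosed_closure (s := S)).isCompact.exists_isLeast hne
  have hmy : y ≤ m := by
    have : closure S ⊆ Set.Ici y := closure_minimal (by rintro _ ⟨n, rfl⟩; exact hc n) isClosed_Ici
    exact this hm
  have hmq : m ≤ q := hml (subset_closure ⟨0, rfl⟩)
  have hfm : f m ∈ closure S := by
    have : Set.MapsTo f S S := by
      rintro _ ⟨n, rfl⟩
      exact ⟨n+1, pow_succ_app f n q⟩
    exact this.closure (cont f) hm
  exact absurd (hml hfm) (not_le.2 (hf m (hy.trans_le hmy) hmq))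

lemma iter_up (f : HomeoI) {p q y : I} (hp : f p = p) (hpq : q < p)
    (hf : ∀ x, q ≤ x → x < p → x < f x) (hy : y < p) :
    ∃ n0 : ℕ, ∀ n ≥ n0, (f ^ n) q < p ∧ y < (f ^ n) q ∧ q ≤ (f ^ n) q := by
  have hb : ∀ n : ℕ, (f ^ n) q < p ∧ q ≤ (f ^ n) q := by
    intro n
    induction n with
    | zero => exact ⟨hpq, le_rfl⟩
    | succ n ih =>
      rw [pow_succ_app]
      refine ⟨?_, ih.2.trans (hf _ ih.2 ih.1).le⟩
      conv_rhs => rw [← hp]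
      exact f.lt_iff_lt.2 ih.1
  have hmono : Monotone fun n : ℕ => (f ^ n) q := by
    apply monotone_nat_of_le_succ
    intro n
    rw [pow_succ_app]
    exact (hf _ (hb n).2 (hb n).1).le
  suffices h : ∃ n : ℕ, y < (f ^ n) q by
    obtain ⟨n, hn⟩ := h
    exact ⟨n, fun k hk => ⟨(hb k).1, hn.trans_le (hmono hk), (hb k).2⟩⟩
  by_contra hc
  push Not at hc
  set S : Set I := Set.range fun n : ℕ => (f ^ n) q with hS
  have hne : (closure S).Nonempty := ⟨q, subset_closure ⟨0, rfl⟩⟩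
  obtain ⟨m, hm, hml⟩ := (isClosed_closure (s := S)).isCompact.exists_isGreatest hne
  have hmy : m ≤ y := by
    have : closure S ⊆ Set.Iic y := closure_minimal (by rintro _ ⟨n, rfl⟩; exact hc n) isClosed_Iic
    exact this hm
  have hmq : q ≤ m := hml (subset_closure ⟨0, rfl⟩)
  have hfm : f m ∈ closure S := by
    have : Set.MapsTo f S S := by
      rintro _ ⟨n, rfl⟩
      exact ⟨n+1, pow_succ_app f n q⟩
    exact this.closure (cont f) hm
  exact absurd (hml hfm) (not_le.2 (hf m hmq (hmy.trans_lt hy)))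

section G
variable {Γ : Subgroup HomeoI} {N : ℕ}

lemma orbit_low (hirr : IrreducibleSubgroup Γ) {x c : I} (hx : x < 1) (hc : 0 < c) :
    ∃ h ∈ Γ, h x < c := by
  set S : Set I := {y | ∃ h ∈ Γ, h x = y} with hS
  have hxS : x ∈ S := ⟨1, Γ.one_mem, rfl⟩
  obtain ⟨m, hm, hml⟩ := (isClosed_closure (s := S)).isCompact.exists_isLeast ⟨x, subset_closure hxS⟩
  have hinv : ∀ h ∈ Γ, h m ∈ closure S := by
    intro h hh
    have : Set.MapsTo h S S := by
      rintro _ ⟨k, hk, rfl⟩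
      exact ⟨h * k, Γ.mul_mem hh hk, rfl⟩
    exact this.closure (cont h) hm
  have hm0 : m = 0 := by
    by_contra hne
    have hpos : 0 < m := lt_of_le_of_ne m.2.1 (Ne.symm hne)
    obtain ⟨h, hh, hne⟩ := hirr m hpos ((hml (subset_closure hxS)).trans_lt hx)
    have h1 := hml (hinv h hh)
    have h2 := hml (hinv _ (Γ.inv_mem hh))
    have h3 : h m ≤ m := by
      have := h.le_iff_le.2 h2
      rwa [app_inv] at this
    exact hne (le_antisymm h3 h1)
  rw [hm0] at hm
  obtain ⟨y, hy, ⟨h, hh, rfl⟩⟩ := mem_closure_iff.1 hm (Set.Iio c) isOpen_Iio hc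
  exact ⟨h, hh, hy⟩

lemma orbit_high (hirr : IrreducibleSubgroup Γ) {x c : I} (hx : 0 < x) (hc : c < 1) :
    ∃ h ∈ Γ, c < h x := by
  rcases eq_or_lt_of_le (show c ≤ 1 from c.2.2) with h | h
  · exact absurd h hc.ne
  obtain ⟨h, hh, hlt⟩ := orbit_low hirr hc hx
  exact ⟨h⁻¹, Γ.inv_mem hh, (lt_inv_iff _ _ _).2 hlt⟩

lemma no_alt (hfix : ∀ f ∈ Γ, f ≠ 1 → (interiorFixedPts f).encard ≤ (N : ℕ∞)) {f : HomeoI}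
    (hf : f ∈ Γ) {x : ℕ → I} (h : Alt (N+1) f x) : False := by
  have h1 : f ≠ 1 := by
    rintro rfl
    exact lt_irrefl _ ((h.2 0 (by omega)).1 (by simp))
  have := (alt_encard h).trans (hfix f hf h1)
  have : N + 1 ≤ N := by exact_mod_cast this
  omega

lemma fin_fix (hfix : ∀ f ∈ Γ, f ≠ 1 → (interiorFixedPts f).encard ≤ (N : ℕ∞)) {f : HomeoI}
    (hf : f ∈ Γ) (h1 : f ≠ 1) : (interiorFixedPts f).Finite :=
  Set.finite_of_encard_le_coe (hfix f hf h1)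

/-- an orbit of a point moved by `h` is not contained in the fixed set of an element -/
lemma exists_pow_move (hfix : ∀ f ∈ Γ, f ≠ 1 → (interiorFixedPts f).encard ≤ (N : ℕ∞))
    {f h : HomeoI} (hf : f ∈ Γ) (h1 : f ≠ 1) {q : I} (h0 : 0 < q) (hq1 : q < 1) (hq : h q ≠ q) :
    ∃ n : ℕ, f ((h ^ n) q) ≠ (h ^ n) q := by
  by_contra hc
  push Not at hc
  have hinj : Function.Injective fun n : ℕ => (h ^ n) q := by
    rcases lt_or_gt_of_ne hq with h' | h'
    · have : StrictAnti fun n : ℕ => (h ^ n) q := by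
        apply strictAnti_nat_of_succ_lt
        intro n
        rw [pow_succ_app']
        exact (h ^ n).lt_iff_lt.2 h'
      exact this.injective
    · have : StrictMono fun n : ℕ => (h ^ n) q := by
        apply strictMono_nat_of_lt_succ
        intro n
        rw [pow_succ_app']
        exact (h ^ n).lt_iff_lt.2 h'
      exact this.injective
  refine Set.infinite_of_injective_forall_mem hinj (s := interiorFixedPts f) ?_ (fin_fix hfix hf h1)
  intro n
  exact mem_ifp.2 ⟨hc n, app_pos _ h0, app_lt_one _ hq1⟩

end G

section Holder
variable {G : Type*} [Group G] [LinearOrder G] [MulLeftMono G] [MulRightMono G]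

lemma holder_pow {c a : G} (hc : 1 < c) (ha : 1 < a) (h : ∃ n : ℕ, a ≤ c ^ n) :
    ∃ n : ℕ, c ^ n < a ∧ a ≤ c ^ (n+1) := by
  classical
  have hf := Nat.find_spec h
  rcases hn : Nat.find h with _ | k
  · rw [hn, pow_zero] at hf
    exact absurd ha (not_lt.2 hf)
  · rw [hn] at hf
    have := Nat.find_min h (m := k) (by omega)
    exact ⟨k, not_le.1 this, hf⟩

lemma holder_pow' {c a : G} (hc : 1 < c) (ha : 1 < a) (h : ∃ n : ℕ, a ≤ c ^ n) :
    ∃ n : ℕ, c ^ n ≤ a ∧ a < c ^ (n+1) := by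
  classical
  have h' : ∃ n : ℕ, a < c ^ n := by
    obtain ⟨n, hn⟩ := h
    refine ⟨n+1, hn.trans_lt ?_⟩
    rw [pow_succ]
    exact lt_mul_of_one_lt_right' _ hc
  have hf := Nat.find_spec h'
  rcases hn : Nat.find h' with _ | k
  · rw [hn, pow_zero] at hf
    exact absurd ha (not_lt.2 hf.le)
  · rw [hn] at hf
    have := Nat.find_min h' (m := k) (by omega)
    exact ⟨k, not_lt.1 this, hf⟩

lemma holder_aux {a b : G} (ha : 1 < a) (hb : 1 < b) (h1 : ∀ x : G, 1 < x → ∃ n : ℕ, a ≤ x ^ n)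
    (h2 : ∀ x : G, 1 < x → ∃ n : ℕ, b ≤ x ^ n) : ¬ (b * a < a * b) := by
  intro hlt
  obtain ⟨c, hc⟩ : ∃ c, c = a * b * (b * a)⁻¹ := ⟨_, rfl⟩
  have hc1 : 1 < c := by rw [hc]; exact lt_mul_inv_iff_mul_lt.2 (by simpa using hlt)
  have hab : a * b = c * (b * a) := by rw [hc]; group
  by_cases he : ∃ e, 1 < e ∧ e < c
  · obtain ⟨e, he1, he2⟩ := he
    obtain ⟨d, hd1, hd2⟩ : ∃ d, 1 < d ∧ d * d ≤ c := by
      refine ⟨min e (e⁻¹ * c), lt_min he1 (lt_inv_mul_iff_mul_lt.2 (by simpa using he2)), ?_⟩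
      calc _ ≤ e * (e⁻¹ * c) := mul_le_mul' (min_le_left _ _) (min_le_right _ _)
        _ = c := by group
    obtain ⟨m, hm1, hm2⟩ := holder_pow' hd1 ha (h1 d hd1)
    obtain ⟨n, hn1, hn2⟩ := holder_pow' hd1 hb (h2 d hd1)
    have e1 : a * b < d ^ (m+1) * d ^ (n+1) := mul_lt_mul_of_lt_of_lt hm2 hn2
    have e2 : d * d * (d ^ n * d ^ m) ≤ a * b := by
      rw [hab]
      exact mul_le_mul' hd2 (mul_le_mul' hn1 hm1)
    have e3 : d * d * (d ^ n * d ^ m) = d ^ (m+1) * d ^ (n+1) := by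
      rw [← pow_add, ← pow_add, ← pow_two, ← pow_add]; congr 1; omega
    rw [e3] at e2
    exact absurd e1 (not_lt.2 e2)
  · push Not at he
    have key : ∀ x : G, 1 < x → (∃ n : ℕ, x ≤ c ^ n) → ∃ n : ℕ, x = c ^ n := by
      intro x hx hn
      obtain ⟨n, hn1, hn2⟩ := holder_pow hc1 hx hn
      refine ⟨n+1, le_antisymm hn2 ?_⟩
      have := he ((c ^ n)⁻¹ * x) (lt_inv_mul_iff_mul_lt.2 (by simpa using hn1))
      rw [pow_succ]
      exact le_inv_mul_iff_mul_le.1 this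
    obtain ⟨m, hm⟩ := key a ha (h1 c hc1)
    obtain ⟨n, hn⟩ := key b hb (h2 c hc1)
    rw [hm, hn, ← pow_add, ← pow_add, add_comm] at hlt
    exact lt_irrefl _ hlt

lemma holder {a b : G} (ha : 1 < a) (hb : 1 < b) (h1 : ∀ x : G, 1 < x → ∃ n : ℕ, a ≤ x ^ n)
    (h2 : ∀ x : G, 1 < x → ∃ n : ℕ, b ≤ x ^ n) : a * b = b * a :=
  le_antisymm (not_lt.1 (holder_aux ha hb h1 h2)) (not_lt.1 (holder_aux hb ha h2 h1))

/-- order-theoretic core of Step 3 -/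
lemma holder_core (f : G) (hf : 1 < f) :
    (∀ h : G, f * (h * f * h⁻¹) = (h * f * h⁻¹) * f) ∨
    ∃ w : G, w ≠ 1 ∧ ∀ j : ℤ, w ^ j < f := by
  by_cases hB : ∃ w : G, w ≠ 1 ∧ ∀ j : ℤ, w ^ j < f
  · exact Or.inr hB
  · left
    push Not at hB
    have h1 : ∀ x : G, 1 < x → ∃ n : ℕ, f ≤ x ^ n := by
      intro x hx
      obtain ⟨j, hj⟩ := hB x hx.ne'
      refine ⟨j.natAbs, hj.trans ?_⟩
      obtain ⟨n, hn | hn⟩ := Int.eq_nat_or_neg j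
      · simp [hn]
      · have h1n : 1 ≤ x ^ n := one_le_pow_of_one_le' hx.le n
        rw [hn]
        simp only [zpow_neg, zpow_natCast, Int.natAbs_neg, Int.natAbs_natCast]
        exact (inv_le_one'.2 h1n).trans h1n
    intro h
    apply holder hf
    · have := mul_lt_mul_left (mul_lt_mul_right hf h) h⁻¹
      simpa using this
    · exact h1
    · intro x hx
      have hx' : 1 < h⁻¹ * x * h := by
        have := mul_lt_mul_left (mul_lt_mul_right hx h⁻¹) h
        simpa using this
      obtain ⟨n, hn⟩ := h1 _ hx'
      refine ⟨n, ?_⟩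
      have e : (h⁻¹ * x * h) ^ n = h⁻¹ * x ^ n * h := by
        have := conj_pow (a := h⁻¹) (b := x) (i := n)
        simpa using this
      rw [e] at hn
      have := mul_le_mul_left (mul_le_mul_right hn h) h⁻¹
      simpa [mul_assoc] using this

lemma conj_mono {f h : G} (hh : f ≤ h * f * h⁻¹) (n : ℕ) : f ≤ h ^ n * f * (h ^ n)⁻¹ := by
  induction n with
  | zero => simp
  | succ n ih =>
    refine hh.trans ?_
    have := mul_le_mul_left (mul_le_mul_right ih h) h⁻¹
    simpa [mul_assoc, pow_succ'] using this

end Holder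

/-- eventually near `1` -/
def Ev (P : I → Prop) : Prop := ∃ p < 1, ∀ z, p < z → z < 1 → P z

lemma Ev.mono {P Q : I → Prop} (h : Ev P) (hPQ : ∀ z, P z → Q z) : Ev Q := by
  obtain ⟨p, h1, h2⟩ := h
  exact ⟨p, h1, fun z h3 h4 => hPQ z (h2 z h3 h4)⟩

lemma Ev.and {P Q : I → Prop} (h : Ev P) (h' : Ev Q) : Ev fun z => P z ∧ Q z := by
  obtain ⟨p, h1, h2⟩ := h
  obtain ⟨q, h3, h4⟩ := h'
  exact ⟨max p q, max_lt h1 h3, fun z h5 h6 => ⟨h2 z ((le_max_left _ _).trans_lt h5) h6,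
    h4 z ((le_max_right _ _).trans_lt h5) h6⟩⟩

lemma Ev.ex {P : I → Prop} (h : Ev P) : ∃ z < 1, P z := by
  obtain ⟨p, h1, h2⟩ := h
  obtain ⟨z, h3, h4⟩ := exists_between h1
  exact ⟨z, h4, h2 z h3 h4⟩

lemma Ev.comp {P : I → Prop} (h : Ev P) (g : HomeoI) : Ev fun z => P (g z) := by
  obtain ⟨p, h1, h2⟩ := h
  exact ⟨g⁻¹ p, app_lt_one _ h1, fun z h3 h4 => h2 _ ((inv_lt_iff _ _ _).1 h3) (app_lt_one _ h4)⟩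

section G
variable {Γ : Subgroup HomeoI} {N : ℕ}

lemma near_one (hfix : ∀ f ∈ Γ, f ≠ 1 → (interiorFixedPts f).encard ≤ (N : ℕ∞)) {f : HomeoI}
    (hf : f ∈ Γ) (h1 : f ≠ 1) : Ev (fun z => z < f z) ∨ Ev (fun z => f z < z) := by
  have hfin := (fin_fix hfix hf h1).insert 0
  obtain ⟨p, hp, hpm⟩ := Set.exists_max_image _ id hfin ⟨0, Set.mem_insert _ _⟩
  have hp1 : p < 1 := by
    rcases hp with rfl | hp
    · exact zero_lt_one
    · exact (mem_ifp.1 hp).2.2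
  have := sign_cases f (S := Set.Ioo p 1) Set.ordConnected_Ioo (by
    rintro x ⟨hx1, hx2⟩ hx3
    have : x ∈ interiorFixedPts f := mem_ifp.2 ⟨hx3, lt_of_le_of_lt p.2.1 hx1, hx2⟩
    exact absurd (hpm x (Set.mem_insert_of_mem _ this)) (not_le.2 hx1))
  rcases this with h | h
  · exact Or.inl ⟨p, hp1, fun z a b => h z ⟨a, b⟩⟩
  · exact Or.inr ⟨p, hp1, fun z a b => h z ⟨a, b⟩⟩

lemma tri (hfix : ∀ f ∈ Γ, f ≠ 1 → (interiorFixedPts f).encard ≤ (N : ℕ∞)) (f g : Γ)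
    (hne : f ≠ g) : Ev (fun z => f.1 z < g.1 z) ∨ Ev (fun z => g.1 z < f.1 z) := by
  have h1 : (f⁻¹ * g).1 ≠ 1 := by
    intro h
    have : f⁻¹ * g = 1 := Subtype.ext h
    exact hne (inv_mul_eq_one.1 this)
  rcases near_one hfix (f⁻¹ * g).2 h1 with h | h
  · left
    refine h.mono fun z hz => ?_
    exact (lt_inv_iff f.1 _ _).1 hz
  · right
    refine h.mono fun z hz => ?_
    exact (inv_lt_iff f.1 _ _).1 hz

/-- the germ order at `1` -/
@[reducible] def germOrder
    (hfix : ∀ f ∈ Γ, f ≠ 1 → (interiorFixedPts f).encard ≤ (N : ℕ∞)) : LinearOrder Γ where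
  le f g := Ev fun z => f.1 z ≤ g.1 z
  lt f g := Ev fun z => f.1 z < g.1 z
  le_refl f := ⟨0, zero_lt_one, fun _ _ _ => le_rfl⟩
  le_trans f g h h1 h2 := (h1.and h2).mono fun z hz => hz.1.trans hz.2
  lt_iff_le_not_ge f g := by
    constructor
    · intro h
      refine ⟨h.mono fun z hz => hz.le, fun h' => ?_⟩
      obtain ⟨z, _, h1, h2⟩ := (h.and h').ex
      exact absurd h1 (not_lt.2 h2)
    · rintro ⟨h1, h2⟩
      have hne : f ≠ g := by
        rintro rfl
        exact h2 h1
      rcases tri hfix f g hne with h | h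
      · exact h
      · exact absurd (h.mono fun z hz => hz.le) h2
  le_antisymm f g h1 h2 := by
    by_contra hne
    rcases tri hfix f g hne with h | h
    · obtain ⟨z, _, h3, h4⟩ := (h.and h2).ex
      exact absurd h3 (not_lt.2 h4)
    · obtain ⟨z, _, h3, h4⟩ := (h.and h1).ex
      exact absurd h3 (not_lt.2 h4)
  le_total f g := by
    by_cases hne : f = g
    · left
      rw [hne]
      exact ⟨0, zero_lt_one, fun _ _ _ => le_rfl⟩
    · rcases tri hfix f g hne with h | h
      · exact Or.inl (h.mono fun z hz => hz.le)
      · exact Or.inr (h.mono fun z hz => hz.le)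
  toDecidableLE := Classical.decRel _

lemma step3 (hirr : IrreducibleSubgroup Γ)
    (hfix : ∀ f ∈ Γ, f ≠ 1 → (interiorFixedPts f).encard ≤ (N : ℕ∞)) {f : HomeoI} (hf : f ∈ Γ)
    (hpos : Ev fun z => z < f z) {q : I} (hq0 : 0 < q) (hq1 : q < 1) (hq : f q = q) :
    ∃ w ∈ Γ, w q ≠ q ∧ ∀ j : ℤ, Ev fun z => (w ^ j) z < f z := by
  let _ : LinearOrder Γ := germOrder hfix
  have _ : MulLeftMono Γ := ⟨fun h a b hab => by
    have hab : Ev fun z => a.1 z ≤ b.1 z := hab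
    exact (hab.mono fun z hz => h.1.le_iff_le.2 hz : Ev fun z => (h * a).1 z ≤ (h * b).1 z)⟩
  have _ : MulRightMono Γ := ⟨fun h a b hab => by
    have hab : Ev fun z => a.1 z ≤ b.1 z := hab
    exact (hab.comp h.1 : Ev fun z => (a * h).1 z ≤ (b * h).1 z)⟩
  have hfne : f ≠ 1 := by
    rintro rfl
    obtain ⟨z, _, hz⟩ := hpos.ex
    exact lt_irrefl _ hz
  obtain ⟨F, hF⟩ : ∃ F : Γ, F = ⟨f, hf⟩ := ⟨_, rfl⟩
  have hFf : F.1 = f := by rw [hF]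
  have hF1 : 1 < F := by
    show Ev fun z => (1 : Γ).1 z < F.1 z
    rw [hFf]; exact hpos
  obtain ⟨h0, hh0, hh0q⟩ := hirr q hq0 hq1
  by_contra hcon
  push Not at hcon
  have hB : ∀ w : Γ, (∀ j : ℤ, w ^ j < F) → w.1 q = q := by
    intro w hw
    by_contra hne
    obtain ⟨j, hj⟩ := hcon w.1 w.2 hne
    apply hj
    have : Ev fun z => (w ^ j).1 z < F.1 z := hw j
    rw [hFf] at this
    simpa using this
  rcases holder_core F hF1 with hcomm | ⟨w, hw1, hw⟩
  · -- f fixes all h⁻¹ q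
    have hall : ∀ h : Γ, F.1 (h⁻¹.1 q) = h⁻¹.1 q := by
      intro h
      obtain ⟨g, hg⟩ : ∃ g : Γ, g = h * F * h⁻¹ := ⟨_, rfl⟩
      have hc : Commute F g := by rw [hg]; exact hcomm h
      have hgq : g.1 q = q := by
        by_contra hne
        obtain ⟨n, hn⟩ := exists_pow_move hfix hf hfne hq0 hq1 hne
        apply hn
        have h1 : F * g ^ n = g ^ n * F := hc.pow_right n
        have h2 : (F * g ^ n).1 q = (g ^ n * F).1 q := by rw [h1]
        have h3 : F.1 ((g.1 ^ n) q) = (g.1 ^ n) (F.1 q) := h2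
        rw [hFf, hq] at h3
        exact h3
      have : h.1 (F.1 (h⁻¹.1 q)) = q := by
        rw [hg] at hgq
        exact hgq
      have h5 := inv_app h.1 (F.1 (h⁻¹.1 q))
      rw [this] at h5
      exact h5.symm
    obtain ⟨n, hn⟩ := exists_pow_move hfix hf hfne hq0 hq1 hh0q
    apply hn
    have := hall (⟨h0, hh0⟩ ^ n)⁻¹
    rw [inv_inv, hFf] at this
    exact this
  · obtain ⟨h, hhq, hh⟩ : ∃ h : Γ, h.1 q ≠ q ∧ F ≤ h * F * h⁻¹ := by
      rcases le_total F (⟨h0, hh0⟩ * F * ⟨h0, hh0⟩⁻¹) with hle | hle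
      · exact ⟨⟨h0, hh0⟩, hh0q, hle⟩
      · refine ⟨⟨h0, hh0⟩⁻¹, ?_, ?_⟩
        · intro hc
          apply hh0q
          have := app_inv h0 q
          rw [show h0⁻¹ q = q from hc] at this
          exact this
        · have := mul_le_mul_left (mul_le_mul_right hle (⟨h0, hh0⟩ : Γ)⁻¹) (⟨h0, hh0⟩ : Γ)
          simpa [mul_assoc] using this
    obtain ⟨n, hn⟩ := exists_pow_move hfix w.2 (fun hc => hw1 (Subtype.ext hc)) hq0 hq1 hhq
    apply hn
    have hb := hB ((h ^ n)⁻¹ * w * h ^ n) (by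
      intro j
      have e : ((h ^ n)⁻¹ * w * h ^ n) ^ j = (h ^ n)⁻¹ * w ^ j * h ^ n := by
        have := conj_zpow (a := (h ^ n)⁻¹) (b := w) (i := j)
        simpa using this
      rw [e]
      have h1 := (hw j).trans_le (conj_mono hh n)
      have := mul_lt_mul_left (mul_lt_mul_right h1 (h ^ n)⁻¹) (h ^ n)
      simpa [mul_assoc] using this)
    have h6 : (h.1 ^ n)⁻¹ (w.1 ((h.1 ^ n) q)) = q := hb
    have h7 := app_inv (h.1 ^ n) (w.1 ((h.1 ^ n) q))
    rw [h6] at h7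
    exact h7.symm

end G

/-- strict derivative at `0` -/
def D (f : HomeoI) (l : ℝ) : Prop :=
  ∀ η > 0, ∃ δ > 0, ∀ x y : I, (x : ℝ) ≤ δ → (y : ℝ) ≤ δ →
    |((f x : ℝ) - f y) - l * (x - y)| ≤ η * |(x : ℝ) - y|

lemma D_of_C1 {f : HomeoI} (hf : IsC1DiffeoI f) : ∃ l > 0, D f l := by
  obtain ⟨F, hF, hFf, hpos⟩ := hf
  refine ⟨derivWithin F (Set.Icc 0 1) 0, hpos 0 (by simp), ?_⟩
  intro η hη
  have hc : ContinuousOn (derivWithin F (Set.Icc 0 1)) (Set.Icc 0 1) :=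
    hF.continuousOn_derivWithin (uniqueDiffOn_Icc zero_lt_one) le_rfl
  have hc0 := hc 0 (by simp)
  obtain ⟨δ, hδ, hδ'⟩ := Metric.continuousWithinAt_iff.1 hc0 η hη
  refine ⟨δ / 2, by positivity, ?_⟩
  intro x y hx hy
  set l := derivWithin F (Set.Icc 0 1) 0 with hl
  have hd : DifferentiableOn ℝ F (Set.Icc 0 1) := hF.differentiableOn (by norm_num)
  set s : Set ℝ := Set.Icc 0 1 ∩ Set.Iic (δ/2) with hs
  have hconv : Convex ℝ s := (convex_Icc 0 1).inter (convex_Iic _)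
  have hder : ∀ z ∈ s, HasDerivWithinAt (fun z => F z - l * z)
      (derivWithin F (Set.Icc 0 1) z - l) s z := by
    intro z hz
    have h1 := ((hd z hz.1).hasDerivWithinAt).mono (t := Set.Icc 0 1) (s := s) Set.inter_subset_left
    have h2 : HasDerivWithinAt (fun z : ℝ => l * z) l s z := by
      simpa using (hasDerivWithinAt_id z s).const_mul l
    exact h1.sub h2
  have hbd : ∀ z ∈ s, ‖derivWithin F (Set.Icc 0 1) z - l‖ ≤ η := by
    intro z hz
    have := hδ' hz.1 (by
      rw [Real.dist_eq, sub_zero, abs_of_nonneg hz.1.1]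
      have : z ≤ δ/2 := hz.2
      linarith)
    rw [Real.dist_eq] at this
    exact this.le
  have := hconv.norm_image_sub_le_of_norm_hasDerivWithin_le hder hbd
    (x := (y : ℝ)) (y := (x : ℝ)) ⟨y.2, hy⟩ ⟨x.2, hx⟩
  rw [Real.norm_eq_abs, Real.norm_eq_abs, hFf, hFf] at this
  calc _ = |(f x : ℝ) - l * x - (f y - l * y)| := by congr 1; ring
    _ ≤ _ := this

lemma D_mul {f g : HomeoI} {l m : ℝ} (hl : 0 < l) (hm : 0 < m) (hf : D f l) (hg : D g m) :
    D (f * g) (l * m) := by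
  intro η hη
  obtain ⟨e2, he2, he2', he2''⟩ : ∃ e2 > 0, e2 ≤ 1 ∧ l * e2 ≤ η / 2 := by
    refine ⟨min 1 (η / (2 * l)), by positivity, min_le_left _ _, ?_⟩
    calc l * min 1 (η / (2 * l)) ≤ l * (η / (2 * l)) := by gcongr; exact min_le_right _ _
      _ = η / 2 := by field_simp
  obtain ⟨e1, he1, he1'⟩ : ∃ e1 > 0, e1 * (m + 1) = η / 2 :=
    ⟨η / (2 * (m+1)), by positivity, by field_simp⟩
  obtain ⟨δ1, hδ1, h1⟩ := hf e1 he1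
  obtain ⟨δ2, hδ2, h2⟩ := hg e2 he2
  refine ⟨min δ2 (δ1 / (m+1)), by positivity, ?_⟩
  have hlip : ∀ x y : I, (x : ℝ) ≤ δ2 → (y : ℝ) ≤ δ2 →
      |(g x : ℝ) - g y| ≤ (m + 1) * |(x : ℝ) - y| := by
    intro x y hx hy
    have h3 := h2 x y hx hy
    calc |(g x : ℝ) - g y| = |(((g x : ℝ) - g y) - m * (x - y)) + m * (x - y)| := by congr 1; ring
      _ ≤ |(((g x : ℝ) - g y) - m * (x - y))| + |m * (x - y)| := abs_add_le _ _
      _ ≤ e2 * |(x : ℝ) - y| + m * |(x : ℝ) - y| := by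
          rw [abs_mul, abs_of_pos hm]; gcongr
      _ ≤ 1 * |(x : ℝ) - y| + m * |(x : ℝ) - y| := by gcongr
      _ = _ := by ring
  have hsm : ∀ x : I, (x : ℝ) ≤ min δ2 (δ1 / (m+1)) → (g x : ℝ) ≤ δ1 := by
    intro x hx
    have := hlip x 0 (hx.trans (min_le_left _ _)) (by simpa using hδ2.le)
    rw [app_zero] at this
    simp only [Set.Icc.coe_zero, sub_zero] at this
    rw [abs_of_nonneg x.2.1] at this
    calc (g x : ℝ) ≤ |(g x : ℝ)| := le_abs_self _
      _ ≤ _ := this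
      _ ≤ (m+1) * (δ1 / (m+1)) := by gcongr; exact hx.trans (min_le_right _ _)
      _ = δ1 := by field_simp
  intro x y hx hy
  have hx2 := hx.trans (min_le_left _ _)
  have hy2 := hy.trans (min_le_left _ _)
  have h3 := h1 (g x) (g y) (hsm x hx) (hsm y hy)
  have h4 := h2 x y hx2 hy2
  have h5 := hlip x y hx2 hy2
  rw [mul_app, mul_app]
  calc |((f (g x) : ℝ) - f (g y)) - l * m * (x - y)|
      = |(((f (g x) : ℝ) - f (g y)) - l * (g x - g y)) + l * (((g x : ℝ) - g y) - m * (x - y))| := by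
        congr 1; ring
    _ ≤ _ := abs_add_le _ _
    _ ≤ e1 * ((m+1) * |(x : ℝ) - y|) + l * (e2 * |(x : ℝ) - y|) := by
        rw [abs_mul, abs_of_pos hl]
        gcongr
        exact h3.trans (by gcongr)
    _ = (e1 * (m+1)) * |(x : ℝ) - y| + (l * e2) * |(x : ℝ) - y| := by ring
    _ ≤ (η/2) * |(x : ℝ) - y| + (η/2) * |(x : ℝ) - y| := by rw [he1']; gcongr
    _ = _ := by ring

/-- words -/
def word (T : Bool → HomeoI) (l : List Bool) : HomeoI := (l.map T).prod

lemma word_cons (T : Bool → HomeoI) (b : Bool) (l : List Bool) (x : I) :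
    word T (b :: l) x = T b (word T l x) := by simp [word]

lemma word_mem {Γ : Subgroup HomeoI} {T : Bool → HomeoI} (hT : ∀ b, T b ∈ Γ) (l : List Bool) :
    word T l ∈ Γ := by
  apply Subgroup.list_prod_mem
  intro x hx
  obtain ⟨b, _, rfl⟩ := List.mem_map.1 hx
  exact hT b

lemma word_lip {T : Bool → HomeoI} {δ A B : ℝ} (hA : 0 ≤ A) (hB : 0 ≤ B)
    (h : ∀ b, ∀ x y : I, x ≤ y → (y : ℝ) ≤ δ →
      A * ((y : ℝ) - x) ≤ (T b y : ℝ) - T b x ∧ (T b y : ℝ) - T b x ≤ B * ((y : ℝ) - x))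
    (hd : ∀ b, ∀ x : I, (x : ℝ) ≤ δ → T b x ≤ x) (l : List Bool) :
    ∀ x y : I, x ≤ y → (y : ℝ) ≤ δ → word T l y ≤ y ∧
      A ^ l.length * ((y : ℝ) - x) ≤ (word T l y : ℝ) - word T l x ∧
      (word T l y : ℝ) - word T l x ≤ B ^ l.length * ((y : ℝ) - x) := by
  induction l with
  | nil => intro x y _ _; simp [word]
  | cons b l ih =>
    intro x y hxy hy
    obtain ⟨h1, h2, h3⟩ := ih x y hxy hy
    have hle : word T l x ≤ word T l y := (word T l).monotone hxy
    have h1' : (word T l y : ℝ) ≤ δ := le_trans h1 hy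
    obtain ⟨h4, h5⟩ := h b _ _ hle h1'
    simp only [word_cons, List.length_cons, pow_succ']
    refine ⟨(hd b _ h1').trans h1, ?_, ?_⟩
    · calc _ = A * (A ^ l.length * ((y : ℝ) - x)) := by ring
        _ ≤ A * ((word T l y : ℝ) - word T l x) := by gcongr
        _ ≤ _ := h4
    · calc _ ≤ _ := h5
        _ ≤ B * (B ^ l.length * ((y : ℝ) - x)) := by gcongr
        _ = _ := by ring

/-- growth estimate -/
lemma growth (k : ℕ) {R C : ℝ} (hR : 1 ≤ R) (hk : R ^ k < 2) (hC : 0 < C) :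
    ∃ n : ℕ, (R ^ n * C + 1) ^ k < 2 ^ n := by
  have h1 : Tendsto (fun n : ℕ => (C + 1) ^ k * (R ^ k / 2) ^ n) atTop (𝓝 ((C+1)^k * 0)) := by
    apply Tendsto.const_mul
    apply tendsto_pow_atTop_nhds_zero_of_lt_one (by positivity)
    linarith
  rw [mul_zero] at h1
  obtain ⟨n, hn⟩ := (h1.eventually (gt_mem_nhds zero_lt_one)).exists
  refine ⟨n, ?_⟩
  have h2 : 1 ≤ R ^ n := one_le_pow₀ hR
  have h3 : (R ^ n * C + 1) ^ k ≤ (R ^ n * (C + 1)) ^ k := by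
    gcongr
    nlinarith
  refine h3.trans_lt ?_
  rw [div_pow, ← mul_div_assoc, div_lt_one (by positivity)] at hn
  calc _ = (C+1)^k * (R^k)^n := by rw [mul_pow, ← pow_mul, ← pow_mul]; ring_nf
    _ < _ := hn

lemma exists_eta (k : ℕ) : ∃ η : ℝ, 0 < η ∧ η < 1 ∧ ((1 + η) / (1 - η)) ^ k < 2 := by
  have hc : ContinuousAt (fun η : ℝ => ((1 + η) / (1 - η)) ^ k) 0 := by
    apply ContinuousAt.pow
    apply ContinuousAt.div
    · fun_prop
    · fun_prop
    · norm_num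
  have h0 : (fun η : ℝ => ((1 + η) / (1 - η)) ^ k) 0 < 2 := by simp
  have h1 := hc.eventually (gt_mem_nhds h0)
  have h2 : ∀ᶠ η : ℝ in 𝓝[>] 0, ((1 + η) / (1 - η)) ^ k < 2 := nhdsWithin_le_nhds h1
  have h3 : ∀ᶠ η : ℝ in 𝓝[>] 0, η ∈ Set.Ioo (0:ℝ) 1 := Ioo_mem_nhdsGT zero_lt_one
  obtain ⟨η, h4, h5⟩ := (h2.and h3).exists
  exact ⟨η, h5.1, h5.2, h4⟩

lemma small_rho {k : ℕ} {δ ρ : ℝ} (y : Fin k → ℝ) (hy : ∀ i, 0 < y i ∧ y i < δ) (hρ : 0 < ρ) :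
    ∃ r > 0, r ≤ ρ ∧ ∀ i, y i + r ≤ δ ∧ 0 ≤ y i - r := by
  have h : ∀ᶠ r : ℝ in 𝓝[>] 0, (r ≤ ρ ∧ ∀ i, y i + r ≤ δ ∧ 0 ≤ y i - r) := by
    apply Filter.Eventually.and
    · exact nhdsWithin_le_nhds (eventually_le_nhds hρ)
    · rw [Filter.eventually_all]
      intro i
      have h1 : ∀ᶠ r : ℝ in 𝓝[>] 0, r ≤ δ - y i :=
        nhdsWithin_le_nhds (eventually_le_nhds (by linarith [(hy i).2]))
      have h2 : ∀ᶠ r : ℝ in 𝓝[>] 0, r ≤ y i :=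
        nhdsWithin_le_nhds (eventually_le_nhds (hy i).1)
      filter_upwards [h1, h2] with r a b
      constructor <;> linarith
  obtain ⟨r, h1, h2⟩ := (h.and self_mem_nhdsWithin).exists
  exact ⟨r, h2, h1⟩

lemma pigeon {Γ : Subgroup HomeoI} {T : Bool → HomeoI} (hT : ∀ b, T b ∈ Γ)
    (hinj : ∀ l l' : List Bool, l.length = l'.length → word T l = word T l' → l = l')
    {lam : ℝ} (hlam : 0 < lam) (hD : ∀ b, D (T b) lam)
    {p : I} (hp : 0 < p) (hdown : ∀ b, ∀ z, z < p → T b z ≤ z) (k : ℕ) :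
    ∃ δ : ℝ, 0 < δ ∧ ∀ y : Fin k → I, (∀ i, 0 < y i ∧ (y i : ℝ) < δ) → ∀ ρ > 0,
      ∃ w ∈ Γ, w ≠ 1 ∧ ∀ i, |(w (y i) : ℝ) - y i| < ρ := by
  obtain ⟨η, hη0, hη1, hηk⟩ := exists_eta k
  have hDD : ∀ b, ∃ δ > 0, ∀ x y : I, (x : ℝ) ≤ δ → (y : ℝ) ≤ δ →
    |((T b x : ℝ) - T b y) - lam * (x - y)| ≤ (lam * η) * |(x : ℝ) - y| :=
    fun b => hD b (lam * η) (by positivity)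
  choose d hd0 hd using hDD
  obtain ⟨δ, hδ0, hδ1, hδp, hδt, hδf⟩ : ∃ δ : ℝ, 0 < δ ∧ δ ≤ 1 ∧ δ < p ∧ δ ≤ d true ∧ δ ≤ d false := by
    have hp' : (0:ℝ) < p := hp
    refine ⟨min (min 1 ((p:ℝ)/2)) (min (d true) (d false)), ?_, ?_, ?_, ?_, ?_⟩
    · have := hd0 true
      have := hd0 false
      positivity
    · exact (min_le_left _ _).trans (min_le_left _ _)
    · refine ((min_le_left _ _).trans (min_le_right _ _)).trans_lt ?_
      linarith
    · exact (min_le_right _ _).trans (min_le_left _ _)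
    · exact (min_le_right _ _).trans (min_le_right _ _)
  set A := lam * (1 - η) with hA
  set B := lam * (1 + η) with hB
  have hA0 : 0 < A := mul_pos hlam (by linarith)
  have hB0 : 0 < B := mul_pos hlam (by linarith)
  have hlip := word_lip (T := T) (δ := δ) hA0.le hB0.le (by
    intro b x y hxy hy
    have hy' : (y : ℝ) ≤ d b := by cases b <;> linarith
    have hxy' : (x : ℝ) ≤ y := hxy
    have := hd b y x hy' (hxy'.trans hy')
    rw [abs_of_nonneg (sub_nonneg.2 hxy')] at this
    have := abs_le.1 this
    constructor
    · rw [hA]; nlinarith [this.1]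
    · rw [hB]; nlinarith [this.2]) (by
    intro b x hx
    exact hdown b x (show (x : ℝ) < p by linarith))
  refine ⟨δ, hδ0, ?_⟩
  intro y hy ρ0 hρ0
  obtain ⟨ρ, hρ, hρle, hρy⟩ := small_rho (fun i => (y i : ℝ)) (δ := δ) (fun i => hy i) hρ0
  set R := B / A with hR
  have hRe : R = (1 + η) / (1 - η) := by
    rw [hR, hA, hB, mul_div_mul_left _ _ hlam.ne']
  have hR1 : 1 ≤ R := by
    rw [hR, one_le_div hA0, hA, hB]; gcongr; linarith
  obtain ⟨n, hn⟩ := growth k hR1 (by rw [hRe]; exact hηk) (C := 1/ρ) (by positivity)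
  set M := ⌊R ^ n * (1/ρ)⌋₊ with hM
  have hAn : 0 < ρ * A ^ n := by positivity
  have hval : ∀ (u : List.Vector Bool n) (i : Fin k),
      ⌊(word T u.1 (y i) : ℝ) / (ρ * A ^ n)⌋₊ < M + 1 := by
    intro u i
    rw [Nat.lt_succ_iff]
    apply Nat.floor_le_floor
    have h1 := (hlip u.1 0 (y i) (y i).2.1 (hy i).2.le).2.2
    rw [app_zero, u.2] at h1
    simp only [Set.Icc.coe_zero, sub_zero] at h1
    rw [div_le_iff₀ hAn]
    calc _ ≤ _ := h1
      _ ≤ B ^ n * 1 := by gcongr; exact (y i).2.2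
      _ = _ := by rw [hR, div_pow]; field_simp
  let Φ : List.Vector Bool n → (Fin k → Fin (M+1)) := fun u i => ⟨_, hval u i⟩
  have hcard : Fintype.card (Fin k → Fin (M+1)) < Fintype.card (List.Vector Bool n) := by
    rw [card_vector]
    simp only [Fintype.card_fun, Fintype.card_fin, Fintype.card_bool]
    have h1 : ((M:ℝ) + 1) ^ k < 2 ^ n := by
      refine lt_of_le_of_lt ?_ hn
      gcongr
      exact Nat.floor_le (by positivity)
    exact_mod_cast h1
  obtain ⟨u, v, huv, hΦ⟩ := Fintype.exists_ne_map_eq_of_card_lt Φ hcard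
  have hclose : ∀ i, |(word T u.1 (y i) : ℝ) - word T v.1 (y i)| < ρ * A ^ n := by
    intro i
    have h1 : ⌊(word T u.1 (y i) : ℝ) / (ρ * A ^ n)⌋₊ = ⌊(word T v.1 (y i) : ℝ) / (ρ * A ^ n)⌋₊ := by
      have := congrFun hΦ i
      exact Fin.mk.inj_iff.1 this
    have hu0 : 0 ≤ (word T u.1 (y i) : ℝ) / (ρ * A ^ n) := div_nonneg (word T u.1 (y i)).2.1 hAn.le
    have hv0 : 0 ≤ (word T v.1 (y i) : ℝ) / (ρ * A ^ n) := div_nonneg (word T v.1 (y i)).2.1 hAn.le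
    have h2 := Nat.floor_le hu0
    have h3 := Nat.floor_le hv0
    have h4 := Nat.lt_floor_add_one ((word T u.1 (y i) : ℝ) / (ρ * A ^ n))
    have h5 := Nat.lt_floor_add_one ((word T v.1 (y i) : ℝ) / (ρ * A ^ n))
    rw [h1] at h2 h4
    have h6 : |(word T u.1 (y i) : ℝ) / (ρ * A ^ n) - (word T v.1 (y i) : ℝ) / (ρ * A ^ n)| < 1 := by
      rw [abs_lt]; constructor <;> linarith
    rw [← sub_div, abs_div, abs_of_pos hAn, div_lt_one hAn] at h6
    exact h6
  refine ⟨(word T u.1)⁻¹ * word T v.1, Γ.mul_mem (Γ.inv_mem (word_mem hT _)) (word_mem hT _), ?_, ?_⟩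
  · intro h
    have h1 := inv_mul_eq_one.1 h
    exact huv (Subtype.ext (hinj _ _ (by rw [u.2, v.2]) h1))
  · intro i
    have hc := abs_lt.1 (hclose i)
    refine lt_of_lt_of_le ?_ hρle
    rw [mul_app, abs_lt]
    constructor
    · let z : I := ⟨y i - ρ, (hρy i).2, by have := (y i).2.2; linarith⟩
      have hz : (z : ℝ) = y i - ρ := rfl
      have h1 := (hlip u.1 z (y i) (by show (z:ℝ) ≤ y i; rw [hz]; linarith) (hy i).2.le).2.1
      rw [u.2, hz] at h1
      have h2 : z < (word T u.1)⁻¹ (word T v.1 (y i)) := by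
        rw [lt_inv_iff]
        show (_ : ℝ) < _
        linarith
      have h3 : (z : ℝ) < _ := h2
      rw [hz] at h3
      linarith
    · let z : I := ⟨y i + ρ, by have := (y i).2.1; linarith, by have := (hρy i).1; linarith⟩
      have hz : (z : ℝ) = y i + ρ := rfl
      have h1 := (hlip u.1 (y i) z (by show (y i:ℝ) ≤ z; rw [hz]; linarith) (by rw [hz]; exact (hρy i).1)).2.1
      rw [u.2, hz] at h1
      have h2 : (word T u.1)⁻¹ (word T v.1 (y i)) < z := by
        rw [inv_lt_iff]
        show (_ : ℝ) < _
        linarith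
      have h3 : _ < (z : ℝ) := h2
      rw [hz] at h3
      linarith

lemma pow_fix {f : HomeoI} {p : I} (h : f p = p) (n : ℕ) : (f ^ n) p = p := by
  induction n with
  | zero => rfl
  | succ n ih => rw [pow_succ_app, ih, h]

lemma inv_fix {f : HomeoI} {p : I} (h : f p = p) : f⁻¹ p = p := (inv_eq_iff _ _ _).2 h.symm

section G
variable {Γ : Subgroup HomeoI} {N : ℕ}

lemma pingpong (hirr : IrreducibleSubgroup Γ)
    (hfix : ∀ f ∈ Γ, f ≠ 1 → (interiorFixedPts f).encard ≤ (N : ℕ∞)) {a : HomeoI} (ha : a ∈ Γ)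
    (ha1 : a ≠ 1) (hne : (interiorFixedPts a).Nonempty) :
    ∃ P ∈ Γ, ∃ Q ∈ Γ, ∃ c d : I, c < d ∧ (∀ x, c ≤ x → x ≤ d → c ≤ P x ∧ P x ≤ d) ∧
      (∀ x, c ≤ x → x ≤ d → c ≤ Q x ∧ Q x ≤ d) ∧ P d < Q c := by
  have hfin := fin_fix hfix ha ha1
  obtain ⟨c, hc, hcm⟩ := Set.exists_min_image _ id hfin hne
  obtain ⟨hac, hc0, hc1⟩ := mem_ifp.1 hc
  obtain ⟨g, hg, hgc⟩ : ∃ g ∈ Γ, c < g c := by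
    obtain ⟨g, hg, hgc⟩ := hirr c hc0 hc1
    rcases lt_or_gt_of_ne hgc with h | h
    · exact ⟨g⁻¹, Γ.inv_mem hg, (lt_inv_iff _ _ _).2 h⟩
    · exact ⟨g, hg, h⟩
  obtain ⟨n, hn⟩ := exists_pow_move hfix ha ha1 hc0 hc1 hgc.ne'
  obtain ⟨G, hG⟩ : ∃ G, G = g ^ n := ⟨_, rfl⟩
  have hGΓ : G ∈ Γ := by rw [hG]; exact Γ.pow_mem hg n
  rw [← hG] at hn
  have hge : ∀ m : ℕ, c ≤ (g ^ m) c := by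
    intro m
    induction m with
    | zero => exact le_rfl
    | succ m ih =>
      rw [pow_succ_app']
      exact ih.trans ((g ^ m).monotone hgc.le)
  obtain ⟨c', hc'⟩ : ∃ c', c' = G c := ⟨_, rfl⟩
  rw [← hc'] at hn
  have hcc' : c < c' := by
    refine lt_of_le_of_ne (by rw [hc', hG]; exact hge n) ?_
    rintro h
    rw [← h] at hn
    exact hn hac
  have hc'1 : c' < 1 := by rw [hc']; exact app_lt_one _ hc1
  obtain ⟨b, hb⟩ : ∃ b, b = G * a * G⁻¹ := ⟨_, rfl⟩
  have hbΓ : b ∈ Γ := by rw [hb]; exact Γ.mul_mem (Γ.mul_mem hGΓ ha) (Γ.inv_mem hGΓ)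
  have hbc' : b c' = c' := by
    rw [hb, hc', mul_app, mul_app, inv_app, hac]
  have hbnf : ∀ x ∈ Set.Ioo 0 c', b x ≠ x := by
    rintro x ⟨hx0, hx1⟩ hbx
    have h1 : G⁻¹ x < c := by rw [inv_lt_iff, ← hc']; exact hx1
    have h2 : a (G⁻¹ x) = G⁻¹ x := by
      have h3 : G (a (G⁻¹ x)) = x := by rw [hb] at hbx; exact hbx
      have h4 := inv_app G (a (G⁻¹ x))
      rw [h3] at h4
      exact h4.symm
    have h3 := hcm (G⁻¹ x) (mem_ifp.2 ⟨h2, app_pos _ hx0, app_lt_one _ (hx1.trans hc'1)⟩)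
    exact absurd h1 (not_lt.2 h3)
  obtain ⟨e, ⟨he, hec⟩, hem⟩ := Set.exists_max_image (interiorFixedPts a ∩ Set.Iic c') id
    (hfin.inter_of_left _) ⟨c, hc, hcc'.le⟩
  obtain ⟨hae, he0, he1⟩ := mem_ifp.1 he
  have hec' : e < c' := by
    refine lt_of_le_of_ne hec ?_
    rintro rfl
    exact hn hae
  have hanf : ∀ x ∈ Set.Ioc e c', a x ≠ x := by
    rintro x ⟨hx0, hx1⟩ hax
    have := hem x ⟨mem_ifp.2 ⟨hax, he0.trans hx0, hx1.trans_lt hc'1⟩, hx1⟩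
    exact absurd hx0 (not_lt.2 this)
  obtain ⟨A, hA, hAe, hAd⟩ : ∃ A ∈ Γ, A e = e ∧ ∀ x, e < x → x ≤ c' → A x < x := by
    rcases sign_cases a Set.ordConnected_Ioc hanf with h | h
    · refine ⟨a⁻¹, Γ.inv_mem ha, inv_fix hae, fun x h1 h2 => ?_⟩
      rw [inv_lt_iff]
      exact h x ⟨h1, h2⟩
    · exact ⟨a, ha, hae, fun x h1 h2 => h x ⟨h1, h2⟩⟩
  obtain ⟨B, hB, hBe, hBu⟩ : ∃ B ∈ Γ, B c' = c' ∧ ∀ x, 0 < x → x < c' → x < B x := by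
    rcases sign_cases b Set.ordConnected_Ioo hbnf with h | h
    · exact ⟨b, hbΓ, hbc', fun x h1 h2 => h x ⟨h1, h2⟩⟩
    · refine ⟨b⁻¹, Γ.inv_mem hbΓ, inv_fix hbc', fun x h1 h2 => ?_⟩
      rw [lt_inv_iff]
      exact h x ⟨h1, h2⟩
  obtain ⟨y, hy1, hy2⟩ := exists_between hec'
  obtain ⟨n1, hn1⟩ := iter_down A hAe hec' hAd hy1
  obtain ⟨n2, hn2⟩ := iter_up B hBe hec' (fun x h1 h2 => hBu x (he0.trans_le h1) h2) hy2
  obtain ⟨p1, p2, p3⟩ := hn1 (max n1 n2) (le_max_left _ _)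
  obtain ⟨q1, q2, q3⟩ := hn2 (max n1 n2) (le_max_right _ _)
  refine ⟨A ^ max n1 n2, Γ.pow_mem hA _, B ^ max n1 n2, Γ.pow_mem hB _, e, c', hec', ?_, ?_,
    p2.trans q2⟩
  · intro x h1 h2
    refine ⟨?_, ((A ^ max n1 n2).monotone h2).trans p3⟩
    have := (A ^ max n1 n2).monotone h1
    rwa [pow_fix hAe] at this
  · intro x h1 h2
    refine ⟨q3.trans ((B ^ max n1 n2).monotone h1), ?_⟩
    have := (B ^ max n1 n2).monotone h2
    rwa [pow_fix hBe] at this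

lemma word_inj {T : Bool → HomeoI} {c d : I} (hcd : c < d)
    (hT : ∀ b, ∀ x, c ≤ x → x ≤ d → c ≤ T b x ∧ T b x ≤ d)
    (hdis : ∀ x y, c ≤ x → x ≤ d → c ≤ y → y ≤ d → T false x < T true y) :
    ∀ l l' : List Bool, l.length = l'.length → word T l = word T l' → l = l' := by
  have hJ : ∀ l : List Bool, c ≤ word T l c ∧ word T l c ≤ d := by
    intro l
    induction l with
    | nil => exact ⟨le_rfl, hcd.le⟩
    | cons b l ih => rw [word_cons]; exact hT b _ ih.1 ih.2
  intro l
  induction l with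
  | nil =>
    intro l' h _
    exact (List.length_eq_zero_iff.1 h.symm).symm
  | cons b l ih =>
    intro l' h hw
    cases l' with
    | nil => simp at h
    | cons b' l' =>
      have hb : b = b' := by
        by_contra hne
        have h1 : word T (b :: l) c = word T (b' :: l') c := by rw [hw]
        rw [word_cons, word_cons] at h1
        cases b <;> cases b'
        · exact hne rfl
        · exact absurd h1 (hdis _ _ (hJ l).1 (hJ l).2 (hJ l').1 (hJ l').2).ne
        · exact absurd h1 (hdis _ _ (hJ l').1 (hJ l').2 (hJ l).1 (hJ l).2).ne'
        · exact hne rfl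
      subst hb
      have h2 : word T l = word T l' := by
        simp only [word, List.map_cons, List.prod_cons] at hw
        exact mul_left_cancel hw
      rw [ih l' (by simpa using h) h2]

lemma word_inj_inv {T : Bool → HomeoI}
    (h : ∀ l l' : List Bool, l.length = l'.length → word T l = word T l' → l = l') :
    ∀ l l' : List Bool, l.length = l'.length →
      word (fun b => (T b)⁻¹) l = word (fun b => (T b)⁻¹) l' → l = l' := by
  have key : ∀ l, word (fun b => (T b)⁻¹) l = (word T l.reverse)⁻¹ := by
    intro l
    simp only [word, List.prod_inv_reverse, List.map_reverse, List.reverse_reverse, List.map_map]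
    rfl
  intro l l' h1 h2
  rw [key, key, inv_inj] at h2
  exact List.reverse_injective (h _ _ (by simpa using h1) h2)

lemma near_zero (hfix : ∀ f ∈ Γ, f ≠ 1 → (interiorFixedPts f).encard ≤ (N : ℕ∞)) {f : HomeoI}
    (hf : f ∈ Γ) (h1 : f ≠ 1) : ∃ p > 0, (∀ z, 0 < z → z < p → z < f z) ∨
      (∀ z, 0 < z → z < p → f z < z) := by
  have hfin := (fin_fix hfix hf h1).insert 1
  obtain ⟨p, hp, hpm⟩ := Set.exists_min_image _ id hfin ⟨1, Set.mem_insert _ _⟩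
  have hp1 : 0 < p := by
    rcases hp with rfl | hp
    · exact zero_lt_one
    · exact (mem_ifp.1 hp).2.1
  have := sign_cases f (S := Set.Ioo 0 p) Set.ordConnected_Ioo (by
    rintro x ⟨hx1, hx2⟩ hx3
    have : x ∈ interiorFixedPts f := mem_ifp.2 ⟨hx3, hx1, lt_of_lt_of_le hx2 p.2.2⟩
    exact absurd (hpm x (Set.mem_insert_of_mem _ this)) (not_le.2 hx2))
  refine ⟨p, hp1, ?_⟩
  rcases this with h | h
  · exact Or.inl fun z a b => h z ⟨a, b⟩
  · exact Or.inr fun z a b => h z ⟨a, b⟩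

lemma free (hdiff : ∀ f ∈ Γ, IsC1DiffeoI f) (hirr : IrreducibleSubgroup Γ)
    (hfix : ∀ f ∈ Γ, f ≠ 1 → (interiorFixedPts f).encard ≤ (N : ℕ∞)) {a : HomeoI} (ha : a ∈ Γ)
    (ha1 : a ≠ 1) (hne : (interiorFixedPts a).Nonempty) :
    ∃ T : Bool → HomeoI, (∀ b, T b ∈ Γ) ∧
      (∀ l l' : List Bool, l.length = l'.length → word T l = word T l' → l = l') ∧
      (∃ lam : ℝ, 0 < lam ∧ ∀ b, D (T b) lam) ∧
      ∃ p : I, 0 < p ∧ ∀ b, ∀ z, z < p → T b z ≤ z := by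
  obtain ⟨P, hP, Q, hQ, c, d, hcd, hPJ, hQJ, hPQ⟩ := pingpong hirr hfix ha ha1 hne
  obtain ⟨T, hT⟩ : ∃ T : Bool → HomeoI, T = fun b => if b then Q * P else P * Q := ⟨_, rfl⟩
  have hTt : T true = Q * P := by rw [hT]; rfl
  have hTf : T false = P * Q := by rw [hT]; rfl
  have hTΓ : ∀ b, T b ∈ Γ := by
    intro b
    cases b
    · rw [hTf]; exact Γ.mul_mem hP hQ
    · rw [hTt]; exact Γ.mul_mem hQ hP
  have hdis : ∀ x y, c ≤ x → x ≤ d → c ≤ y → y ≤ d → T false x < T true y := by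
    intro x y hx1 hx2 hy1 hy2
    rw [hTf, hTt, mul_app, mul_app]
    calc P (Q x) ≤ P d := P.monotone (hQJ x hx1 hx2).2
      _ < Q c := hPQ
      _ ≤ Q (P y) := Q.monotone (hPJ y hy1 hy2).1
  have hinj := word_inj (T := T) hcd (by
    intro b x h1 h2
    cases b
    · rw [hTf, mul_app]
      have := hQJ x h1 h2
      exact hPJ _ this.1 this.2
    · rw [hTt, mul_app]
      have := hPJ x h1 h2
      exact hQJ _ this.1 this.2) hdis
  have hlam : ∀ P ∈ Γ, ∀ Q ∈ Γ, ∃ lam : ℝ, 0 < lam ∧ D (P * Q) lam ∧ D (Q * P) lam := by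
    intro P hP Q hQ
    obtain ⟨l, hl, hDl⟩ := D_of_C1 (hdiff P hP)
    obtain ⟨m, hm, hDm⟩ := D_of_C1 (hdiff Q hQ)
    refine ⟨l * m, by positivity, D_mul hl hm hDl hDm, ?_⟩
    rw [mul_comm]
    exact D_mul hm hl hDm hDl
  have hT1 : T false ≠ 1 := by
    intro h
    rw [hTf] at h
    have h2 : Q * P = 1 := mul_eq_one_iff_eq_inv.2 (mul_eq_one_iff_eq_inv'.1 h)
    have := hdis c c le_rfl hcd.le le_rfl hcd.le
    rw [hTf, hTt, h, h2] at this
    exact lt_irrefl _ this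
  obtain ⟨p, hp, hup | hdn⟩ := near_zero hfix (hTΓ false) hT1
  · refine ⟨fun b => (T b)⁻¹, fun b => Γ.inv_mem (hTΓ b), word_inj_inv hinj, ?_, ?_⟩
    · obtain ⟨lam, h0, h1, h2⟩ := hlam P⁻¹ (Γ.inv_mem hP) Q⁻¹ (Γ.inv_mem hQ)
      refine ⟨lam, h0, ?_⟩
      intro b
      cases b
      · simp only [hTf, mul_inv_rev]; exact h2
      · simp only [hTt, mul_inv_rev]; exact h1
    · refine ⟨min p (P⁻¹ p), lt_min hp (app_pos _ hp), ?_⟩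
      intro b z hz
      rcases eq_or_lt_of_le (show 0 ≤ z from z.2.1) with h0 | h0
      · rw [← h0, app_zero]
      have hz1 := hz.trans_le (min_le_left _ _)
      have hz2 : P z < p := (lt_inv_iff _ _ _).1 (hz.trans_le (min_le_right _ _))
      refine le_of_lt ((inv_lt_iff _ _ _).2 ?_)
      cases b
      · exact hup z h0 hz1
      · have := hup (P z) (app_pos _ h0) hz2
        rw [hTf, mul_app, P.lt_iff_lt] at this
        rw [hTt]; exact this
  · refine ⟨T, hTΓ, hinj, ?_, ?_⟩
    · obtain ⟨lam, h0, h1, h2⟩ := hlam P hP Q hQ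
      refine ⟨lam, h0, ?_⟩
      intro b
      cases b
      · rw [hTf]; exact h1
      · rw [hTt]; exact h2
    · refine ⟨min p (P⁻¹ p), lt_min hp (app_pos _ hp), ?_⟩
      intro b z hz
      rcases eq_or_lt_of_le (show 0 ≤ z from z.2.1) with h0 | h0
      · rw [← h0, app_zero]
      have hz1 := hz.trans_le (min_le_left _ _)
      have hz2 : P z < p := (lt_inv_iff _ _ _).1 (hz.trans_le (min_le_right _ _))
      refine le_of_lt ?_
      cases b
      · exact hdn z h0 hz1
      · have := hdn (P z) (app_pos _ h0) hz2
        rw [hTf, mul_app, P.lt_iff_lt] at this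
        rw [hTt]; exact this

/-- the pigeonhole lemma for `Γ` -/
lemma pigeonΓ (hdiff : ∀ f ∈ Γ, IsC1DiffeoI f) (hirr : IrreducibleSubgroup Γ)
    (hfix : ∀ f ∈ Γ, f ≠ 1 → (interiorFixedPts f).encard ≤ (N : ℕ∞)) {a : HomeoI} (ha : a ∈ Γ)
    (ha1 : a ≠ 1) (hne : (interiorFixedPts a).Nonempty) (k : ℕ) :
    ∃ δ : ℝ, 0 < δ ∧ ∀ y : Fin k → I, (∀ i, 0 < y i ∧ (y i : ℝ) < δ) → ∀ ρ > 0,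
      ∃ w ∈ Γ, w ≠ 1 ∧ ∀ i, |(w (y i) : ℝ) - y i| < ρ := by
  obtain ⟨T, hT, hinj, ⟨lam, hlam, hD⟩, p, hp, hdown⟩ := free hdiff hirr hfix ha ha1 hne
  exact pigeon hT hinj hlam hD hp hdown k

end G

lemma fin_rho {ι : Type*} [Finite ι] {P : ι → ℝ → Prop}
    (h : ∀ i, ∃ r > 0, ∀ r' > 0, r' ≤ r → P i r') : ∃ r > 0, ∀ i, P i r := by
  have : ∀ᶠ r : ℝ in 𝓝[>] 0, ∀ i, P i r := by
    rw [Filter.eventually_all]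
    intro i
    obtain ⟨r, hr, h⟩ := h i
    filter_upwards [self_mem_nhdsWithin, Ioc_mem_nhdsGT hr] with r' h1 h2
    exact h r' h1 h2.2
  obtain ⟨r, h1, h2⟩ := (this.and self_mem_nhdsWithin).exists
  exact ⟨r, h2, h1⟩

lemma grid_close {W : HomeoI} {K : ℕ} (hK : 0 < K)
    (h : ∀ j : ℕ, ∀ x : I, (x : ℝ) = j / K → |(W x : ℝ) - x| < 1 / K) (x : I) :
    |(W x : ℝ) - x| < 3 / K := by
  have hK' : (0:ℝ) < K := by exact_mod_cast hK
  have hx0 : (0:ℝ) ≤ x * K := mul_nonneg x.2.1 hK'.le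
  obtain ⟨j, hj⟩ : ∃ j, j = ⌊(x : ℝ) * K⌋₊ := ⟨_, rfl⟩
  have h1 := Nat.floor_le hx0
  have h2 := Nat.lt_floor_add_one ((x : ℝ) * K)
  rw [← hj] at h1 h2
  have h1' : (j : ℝ) / K ≤ x := by rw [div_le_iff₀ hK']; exact h1
  have h2' : (x : ℝ) < ((j+1 : ℕ) : ℝ) / K := by rw [lt_div_iff₀ hK']; push_cast; exact h2
  have e : ((j+1 : ℕ) : ℝ) / K = j / K + 1 / K := by push_cast; ring
  have hK1 : (0:ℝ) < 1 / K := by positivity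
  have e3 : (3:ℝ) / K = 1 / K + 1 / K + 1 / K := by ring
  rw [abs_lt]
  constructor
  · let z : I := ⟨j / K, by positivity, h1'.trans x.2.2⟩
    have h3 := abs_lt.1 (h j z rfl)
    have h4 : (W z : ℝ) ≤ W x := W.monotone (show z ≤ x from h1')
    have h5 : (z : ℝ) = j / K := rfl
    linarith [h3.1]
  · by_cases hle : ((j+1 : ℕ) : ℝ) / K ≤ 1
    · let z : I := ⟨((j+1 : ℕ) : ℝ) / K, by positivity, hle⟩
      have h3 := abs_lt.1 (h (j+1) z rfl)
      have h4 : (W x : ℝ) ≤ W z := W.monotone (show x ≤ z from h2'.le)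
      have h5 : (z : ℝ) = ((j+1 : ℕ) : ℝ) / K := rfl
      linarith [h3.2]
    · push Not at hle
      have := (W x).2.2
      linarith

section G
variable {Γ : Subgroup HomeoI} {N : ℕ}

lemma small (hirr : IrreducibleSubgroup Γ)
    (hfix : ∀ f ∈ Γ, f ≠ 1 → (interiorFixedPts f).encard ≤ (N : ℕ∞))
    (hLP : ∀ k : ℕ, ∃ δ : ℝ, 0 < δ ∧ ∀ y : Fin k → I, (∀ i, 0 < y i ∧ (y i : ℝ) < δ) → ∀ ρ > 0,
      ∃ w ∈ Γ, w ≠ 1 ∧ ∀ i, |(w (y i) : ℝ) - y i| < ρ) {ε : ℝ} (hε : 0 < ε) :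
    ∃ w ∈ Γ, (∀ x : I, |(w x : ℝ) - x| < ε) ∧ ∀ x : I, ε ≤ x → (x : ℝ) ≤ 1 - ε → x < w x := by
  obtain ⟨K0, hK0⟩ := exists_nat_gt (3 / ε)
  obtain ⟨K, hK⟩ : ∃ K, K = K0 + 2 := ⟨_, rfl⟩
  have hK2 : (2:ℝ) ≤ K := by rw [hK]; push_cast; linarith [(Nat.cast_nonneg K0 : (0:ℝ) ≤ K0)]
  have hKpos : (0:ℝ) < K := by linarith
  have hKε : 3 / (K:ℝ) < ε := by
    have : 3 / ε < K := by rw [hK]; push_cast; linarith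
    rw [div_lt_iff₀ hε] at this
    rw [div_lt_iff₀ hKpos]
    linarith
  have hK1 : (0:ℝ) < 1 / K := by positivity
  have hKh : 1 / (K:ℝ) ≤ 1 / 2 := one_div_le_one_div_of_le (by norm_num) hK2
  have e3 : (3:ℝ) / K = 1 / K + 1 / K + 1 / K := by ring
  let lo : I := ⟨1 / K, hK1.le, by linarith⟩
  let hi : I := ⟨1 - 1 / K, by linarith, by linarith⟩
  have hlo : (lo : ℝ) = 1 / K := rfl
  have hhi : (hi : ℝ) = 1 - 1 / K := rfl
  have hlo0 : 0 < lo := hK1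
  have hhi1 : hi < 1 := show (hi : ℝ) < 1 by rw [hhi]; linarith
  have hlohi : lo ≤ hi := show (lo : ℝ) ≤ hi by rw [hlo, hhi]; linarith
  obtain ⟨δ, hδ, hLP⟩ := hLP ((N+1) * (K-1))
  let δ' : I := ⟨min δ 1, by positivity, min_le_right _ _⟩
  have hδ' : 0 < δ' := show (0:ℝ) < min δ 1 by positivity
  have hδ'' : (δ' : ℝ) ≤ δ := min_le_left _ _
  have hH : ∀ c : I, ∃ h ∈ Γ, 0 < c → h hi < c := by
    intro c
    by_cases hc : 0 < c
    · obtain ⟨h, h1, h2⟩ := orbit_low hirr hhi1 hc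
      exact ⟨h, h1, fun _ => h2⟩
    · exact ⟨1, Γ.one_mem, fun h => absurd h hc⟩
  choose H hHΓ hH using hH
  obtain ⟨h, hh0, hhs⟩ : ∃ h : ℕ → HomeoI, h 0 = H δ' ∧ ∀ n, h (n+1) = H (h n lo) :=
    ⟨fun n => Nat.rec (H δ') (fun _ g => H (g lo)) n, rfl, fun _ => rfl⟩
  have hhΓ : ∀ n, h n ∈ Γ := by
    intro n
    cases n with
    | zero => rw [hh0]; exact hHΓ _
    | succ n => rw [hhs]; exact hHΓ _
  have hstep : ∀ n, h (n+1) hi < h n lo := by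
    intro n
    rw [hhs]
    exact hH _ (app_pos _ hlo0)
  have hlt : ∀ i j, i < j → h j hi < h i lo := by
    intro i j hij
    induction j, hij using Nat.le_induction with
    | base => exact hstep i
    | succ j _ ih => exact (hstep j).trans_le (((h j).monotone hlohi).trans ih.le)
  have hδh : ∀ n, h n hi < δ' := by
    intro n
    have h0 : h 0 hi < δ' := by rw [hh0]; exact hH _ hδ'
    rcases Nat.eq_zero_or_pos n with rfl | hn
    · exact h0
    · exact (hlt 0 n hn).trans_le (((h 0).monotone hlohi).trans h0.le)
  have hjK : ∀ j : Fin (K-1), ((j:ℕ):ℝ) + 1 ≤ K - 1 := by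
    intro j
    have := j.2
    have h2 : (j : ℕ) + 1 + 1 ≤ K := by omega
    have h3 : (((j : ℕ) + 1 + 1 : ℕ) : ℝ) ≤ K := by exact_mod_cast h2
    push_cast at h3
    linarith
  have hjK' : ∀ j : Fin (K-1), (((j:ℕ):ℝ) + 1) / K ≤ 1 - 1 / K := by
    intro j
    rw [div_le_iff₀ hKpos]
    have : (1 - 1 / (K:ℝ)) * K = K - 1 := by field_simp
    rw [this]
    exact hjK j
  let t : Fin (K-1) → I := fun j => ⟨(((j:ℕ):ℝ) + 1) / K, by positivity, by linarith [hjK' j]⟩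
  have ht0 : ∀ j, 0 < t j := fun j => show (0:ℝ) < (((j:ℕ):ℝ) + 1) / K by positivity
  have hthi : ∀ j, t j ≤ hi := fun j => hjK' j
  let y : Fin ((N+1) * (K-1)) → I := fun e => h (finProdFinEquiv.symm e).1 (t (finProdFinEquiv.symm e).2)
  obtain ⟨ρ, hρ, hρ'⟩ : ∃ r > 0, ∀ q : Fin (N+1) × Fin (K-1), ∀ z : I,
      |(z : ℝ) - h q.1 (t q.2)| < r → |(((h q.1)⁻¹ z : I) : ℝ) - t q.2| < 1 / K := by
    apply fin_rho (P := fun (q : Fin (N+1) × Fin (K-1)) (r : ℝ) => ∀ z : I,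
      |(z : ℝ) - h q.1 (t q.2)| < r → |(((h q.1)⁻¹ z : I) : ℝ) - t q.2| < 1 / K)
    intro q
    have hc := (cont (h q.1)⁻¹).continuousAt (x := h q.1 (t q.2))
    obtain ⟨r, hr, hr'⟩ := Metric.continuousAt_iff.1 hc (1 / K) hK1
    refine ⟨r, hr, fun r' _ hle z hz => ?_⟩
    have := hr' (show dist z (h q.1 (t q.2)) < r from lt_of_lt_of_le hz hle)
    rw [inv_app] at this
    exact this
  obtain ⟨w, hw, hw1, hwy⟩ := hLP y (by
    intro e
    refine ⟨app_pos _ (ht0 _), ?_⟩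
    have h1 : y e < δ' := ((h _).monotone (hthi _)).trans_lt (hδh _)
    exact lt_of_lt_of_le h1 hδ'') ρ hρ
  have hexi : ∃ i : Fin (N+1), ∀ p, h i lo ≤ p → p ≤ h i hi → w p ≠ p := by
    by_contra hcon
    push Not at hcon
    choose p hp1 hp2 hp3 using hcon
    have hanti : StrictAnti p := by
      intro i j hij
      exact (hp2 j).trans_lt ((hlt i j hij).trans_le (hp1 i))
    have hsub : Set.range p ⊆ interiorFixedPts w := by
      rintro _ ⟨i, rfl⟩
      exact mem_ifp.2 ⟨hp3 i, (app_pos _ hlo0).trans_le (hp1 i),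
        (hp2 i).trans_lt (app_lt_one _ hhi1)⟩
    have hcard : (Set.range p).encard = ((N+1 : ℕ) : ℕ∞) := by
      rw [← Set.image_univ, hanti.injective.encard_image]; simp
    have := (Set.encard_le_encard hsub).trans (hfix w hw hw1)
    rw [hcard] at this
    have : N + 1 ≤ N := by exact_mod_cast this
    omega
  obtain ⟨i, hi'⟩ := hexi
  obtain ⟨W, hW⟩ : ∃ W, W = (h i)⁻¹ * w * h i := ⟨_, rfl⟩
  have hWΓ : W ∈ Γ := by
    rw [hW]; exact Γ.mul_mem (Γ.mul_mem (Γ.inv_mem (hhΓ _)) hw) (hhΓ _)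
  have hWx : ∀ x, W x = (h i)⁻¹ (w (h i x)) := fun x => by rw [hW]; rfl
  have hclose : ∀ x : I, |(W x : ℝ) - x| < 3 / K := by
    apply grid_close (by omega)
    intro j x hx
    by_cases hx0 : x = 0
    · rw [hx0, app_zero]; simpa using hK1
    by_cases hx1 : x = 1
    · rw [hx1, app_one]; simpa using hK1
    have hx0' : (0:ℝ) < x := lt_of_le_of_ne x.2.1 (fun h => hx0 (Subtype.ext h.symm))
    have hx1' : (x:ℝ) < 1 := lt_of_le_of_ne x.2.2 (fun h => hx1 (Subtype.ext h))
    have hj0 : 0 < j := by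
      rcases Nat.eq_zero_or_pos j with rfl | h
      · simp at hx; exact absurd hx hx0
      · exact h
    have hj1 : j < K := by
      rw [hx, div_lt_one hKpos] at hx1'
      exact_mod_cast hx1'
    let j' : Fin (K-1) := ⟨j-1, by omega⟩
    have hxt : x = t j' := by
      apply Subtype.ext
      rw [hx]
      show _ = (((j-1:ℕ):ℝ) + 1) / K
      congr 1
      have : j = (j - 1) + 1 := by omega
      exact_mod_cast this
    have hyy := hwy (finProdFinEquiv (i, j'))
    have hye : y (finProdFinEquiv (i, j')) = h i (t j') := by
      simp only [y, Equiv.symm_apply_apply]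
    rw [hye] at hyy
    have := hρ' (i, j') _ hyy
    rw [hWx, hxt]
    exact this
  have hnf : ∀ x ∈ Set.Icc lo hi, W x ≠ x := by
    rintro x ⟨h1, h2⟩ hx
    apply hi' (h i x) ((h i).monotone h1) ((h i).monotone h2)
    rw [hWx] at hx
    have := app_inv (h i) (w (h i x))
    rw [hx] at this
    exact this.symm
  have hmem : ∀ x : I, ε ≤ x → (x : ℝ) ≤ 1 - ε → x ∈ Set.Icc lo hi := by
    intro x h1 h2
    constructor
    · show (1:ℝ) / K ≤ x; linarith
    · show (x:ℝ) ≤ 1 - 1 / K; linarith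
  rcases sign_cases W Set.ordConnected_Icc hnf with hs | hs
  · exact ⟨W, hWΓ, fun x => (hclose x).trans hKε, fun x h1 h2 => hs x (hmem x h1 h2)⟩
  · refine ⟨W⁻¹, Γ.inv_mem hWΓ, fun x => ?_, fun x h1 h2 => ?_⟩
    · have := hclose (W⁻¹ x)
      rw [app_inv, abs_sub_comm] at this
      exact this.trans hKε
    · rw [lt_inv_iff]
      exact hs x (hmem x h1 h2)

end G

lemma escape (g : HomeoI) {y z : I} (h : ∀ x, y ≤ x → x ≤ z → x < g x) :
    ∃ J : ℕ, z < (g ^ J) y := by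
  by_contra hc
  push Not at hc
  have hb : ∀ n : ℕ, y ≤ (g ^ n) y := by
    intro n
    induction n with
    | zero => exact le_rfl
    | succ n ih =>
      rw [pow_succ_app]
      exact ih.trans (h _ ih (hc n)).le
  set S : Set I := Set.range fun n : ℕ => (g ^ n) y with hS
  have hne : (closure S).Nonempty := ⟨y, subset_closure ⟨0, rfl⟩⟩
  obtain ⟨m, hm, hml⟩ := (isClosed_closure (s := S)).isCompact.exists_isGreatest hne
  have hmy : m ≤ z := by
    have : closure S ⊆ Set.Iic z := closure_minimal (by rintro _ ⟨n, rfl⟩; exact hc n) isClosed_Iic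
    exact this hm
  have hmq : y ≤ m := hml (subset_closure ⟨0, rfl⟩)
  have hfm : g m ∈ closure S := by
    have : Set.MapsTo g S S := by
      rintro _ ⟨n, rfl⟩
      exact ⟨n+1, pow_succ_app g n y⟩
    exact this.closure (cont g) hm
  exact absurd (hml hfm) (not_le.2 (h m hmq hmy))

lemma slow (g k : HomeoI) {y z : I} {J : ℕ} (hy : y < 1) (hk : ∀ x, y ≤ x → x < 1 → x < k x)
    (h1 : (k ^ J) y < z) (h2 : z < (g ^ J) y) : ∃ c, y ≤ c ∧ c ≤ z ∧ k c < g c := by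
  by_contra hc
  push Not at hc
  have hge : ∀ j : ℕ, y ≤ (k ^ j) y := by
    intro j
    induction j with
    | zero => exact le_rfl
    | succ j ih =>
      rw [pow_succ_app]
      exact ih.trans (hk _ ih (app_lt_one _ hy)).le
  have hmono : Monotone fun j : ℕ => (k ^ j) y := by
    apply monotone_nat_of_le_succ
    intro j
    rw [pow_succ_app]
    exact (hk _ (hge j) (app_lt_one _ hy)).le
  have key : ∀ j : ℕ, j ≤ J → (g ^ j) y ≤ (k ^ j) y := by
    intro j
    induction j with
    | zero => intro _; exact le_rfl
    | succ j ih =>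
      intro hj
      rw [pow_succ_app, pow_succ_app]
      have h3 := ih (by omega)
      have h4 : (k ^ j) y ≤ (k ^ J) y := hmono (by omega)
      exact (g.monotone h3).trans (hc _ (hge j) (h4.trans h1.le))
  exact absurd (h1.trans h2) (not_lt.2 (key J le_rfl))

lemma unif_gap (F : HomeoI) {δ : ℝ} (hδ : 0 < δ) :
    ∃ r > 0, ∀ x y : I, (x : ℝ) + δ ≤ y → (F x : ℝ) + r ≤ F y := by
  have huc := CompactSpace.uniformContinuous_of_continuous (cont F⁻¹)
  obtain ⟨r, hr, h⟩ := Metric.uniformContinuous_iff.1 huc δ hδ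
  refine ⟨r, hr, fun x y hxy => ?_⟩
  by_contra hc
  push Not at hc
  have hle : (F x : ℝ) ≤ F y := F.monotone (show (x:ℝ) ≤ y by linarith)
  have h1 : dist (F y) (F x) < r := by
    show |(F y : ℝ) - F x| < r
    rw [abs_of_nonneg (by linarith)]
    linarith
  have h2 := h h1
  rw [inv_app, inv_app] at h2
  have h3 : |(y : ℝ) - x| < δ := h2
  linarith [le_abs_self ((y:ℝ) - x)]

/-- the conjugates -/
def kk (f w : HomeoI) (n : ℕ) : HomeoI := (f ^ n)⁻¹ * w * f ^ n

lemma kk_app (f w : HomeoI) (n : ℕ) (x : I) : kk f w n x = (f ^ n)⁻¹ (w ((f ^ n) x)) := rfl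

lemma kk_pow (f w : HomeoI) (n j : ℕ) (x : I) :
    (kk f w n ^ j) x = (f ^ n)⁻¹ ((w ^ j) ((f ^ n) x)) := by
  have : kk f w n ^ j = (f ^ n)⁻¹ * w ^ j * f ^ n := by
    have := conj_pow (a := (f ^ n)⁻¹) (b := w) (i := j)
    simpa [kk] using this
  rw [this]; rfl

lemma kk_shift (f w : HomeoI) (n m : ℕ) (x : I) :
    kk f w n ((f ^ m) x) = (f ^ m) (kk f w (n+m) x) := by
  have : kk f w n * f ^ m = f ^ m * kk f w (n+m) := by
    have e : f ^ (n+m) = f ^ n * f ^ m := pow_add f n m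
    unfold kk
    rw [e, mul_inv_rev]
    have c : f ^ n * f ^ m = f ^ m * f ^ n := by rw [← pow_add, ← pow_add, add_comm]
    group
  exact DFunLike.congr_fun this x

lemma kk_inv (f w : HomeoI) (n : ℕ) : kk f w⁻¹ n = (kk f w n)⁻¹ := by
  simp [kk, mul_assoc]

lemma kk_mem {Γ : Subgroup HomeoI} {f w : HomeoI} (hf : f ∈ Γ) (hw : w ∈ Γ) (n : ℕ) :
    kk f w n ∈ Γ :=
  Γ.mul_mem (Γ.mul_mem (Γ.inv_mem (Γ.pow_mem hf n)) hw) (Γ.pow_mem hf n)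

lemma thresh {f : HomeoI} {s : I} (hs : s < 1) (hup : ∀ x, s ≤ x → x < 1 → x < f x)
    {P : I → Prop} (hP : Ev P) :
    ∃ n1 : ℕ, ∀ n ≥ n1, ∀ x, s ≤ x → x < 1 → P ((f ^ n) x) := by
  obtain ⟨p, hp, h⟩ := hP
  obtain ⟨n1, hn1⟩ := iter_up f (app_one f) hs hup hp
  refine ⟨n1, fun n hn x hx hx1 => h _ ?_ (app_lt_one _ hx1)⟩
  exact (hn1 n hn).2.1.trans_le ((f ^ n).monotone hx)

section G
variable {Γ : Subgroup HomeoI} {N : ℕ}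

lemma bump_pos (hfix : ∀ f ∈ Γ, f ≠ 1 → (interiorFixedPts f).encard ≤ (N : ℕ∞))
    (hsm : ∀ ε : ℝ, 0 < ε → ∃ w ∈ Γ, (∀ x : I, |(w x : ℝ) - x| < ε) ∧
      ∀ x : I, ε ≤ x → (x : ℝ) ≤ 1 - ε → x < w x)
    {f w : HomeoI} (hf : f ∈ Γ) (hw : w ∈ Γ) {s t : I} (hs0 : 0 < s) (hst : s ≤ t) (ht : t < 1)
    (hup : ∀ x, s ≤ x → x < 1 → x < f x)
    (hwpos : Ev fun z => z < w z) (hwj : ∀ j : ℕ, Ev fun z => (w ^ j) z < f z)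
    {δ : ℝ} (hδ : 0 < δ) (n0 : ℕ) :
    ∃ n ≥ n0, ∀ x : I, s ≤ x → x ≤ t → x < kk f w n x ∧ (kk f w n x : ℝ) < x + δ := by
  have hs1 : s < 1 := hst.trans_lt ht
  obtain ⟨n1, hn1⟩ := thresh hs1 hup hwpos
  have hkpos : ∀ n ≥ n1, ∀ x, s ≤ x → x < 1 → x < kk f w n x := by
    intro n hn x hx hx1
    rw [kk_app, lt_inv_iff]
    exact hn1 n hn x hx hx1
  by_contra hcon
  push Not at hcon
  have hX : ∀ n, ∃ x : I, n ≥ max n0 n1 → s ≤ x ∧ x ≤ t ∧ (x : ℝ) + δ ≤ kk f w n x := by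
    intro n
    by_cases hn : n ≥ max n0 n1
    · obtain ⟨x, h1, h2, h3⟩ := hcon n ((le_max_left _ _).trans hn)
      exact ⟨x, fun _ => ⟨h1, h2, h3 (hkpos n ((le_max_right _ _).trans hn) x h1 (h2.trans_lt ht))⟩⟩
    · exact ⟨0, fun h => absurd h hn⟩
  choose X hX using hX
  -- iterates of f go up
  have hfge : ∀ x, s ≤ x → ∀ m : ℕ, x ≤ (f ^ m) x := by
    intro x hx m
    induction m with
    | zero => exact le_rfl
    | succ m ih =>
      rw [pow_succ_app]
      rcases eq_or_lt_of_le (show (f ^ m) x ≤ 1 from ((f ^ m) x).2.2) with h | h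
      · rw [h, app_one]; exact x.2.2
      · exact ih.trans (hup _ (hx.trans ih) h).le
  obtain ⟨q, hq⟩ := iter_up f (app_one f) hs1 hup (app_lt_one f ht)
  have hq := (hq q le_rfl).2.1
  -- gaps
  obtain ⟨δ', hδ', hgap⟩ : ∃ r > 0, ∀ i : Fin (N+2), ∀ x y : I, (x : ℝ) + δ ≤ y →
      ((f ^ (q * i)) x : ℝ) + r ≤ (f ^ (q * i)) y := by
    apply fin_rho (P := fun (i : Fin (N+2)) (r : ℝ) => ∀ x y : I, (x : ℝ) + δ ≤ y →
      ((f ^ (q * i)) x : ℝ) + r ≤ (f ^ (q * i)) y)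
    intro i
    obtain ⟨r, hr, h⟩ := unif_gap (f ^ (q * (i:ℕ))) hδ
    exact ⟨r, hr, fun r' _ hle x y hxy => by linarith [h x y hxy]⟩
  obtain ⟨Y, hY⟩ : ∃ Y, Y = (f ^ (q * (N+1) + 1)) t := ⟨_, rfl⟩
  have hY1 : Y < 1 := by rw [hY]; exact app_lt_one _ ht
  have hYle : ∀ m ≤ q * (N+1) + 1, (f ^ m) t ≤ Y := by
    intro m hm
    obtain ⟨r, hr⟩ := Nat.exists_eq_add_of_le hm
    rw [hY, hr, add_comm, pow_add]
    exact hfge _ (hst.trans (hfge t hst m)) r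
  obtain ⟨ε, hε, hε1, hε2, hε3⟩ : ∃ ε : ℝ, 0 < ε ∧ ε ≤ δ' ∧ ε ≤ s ∧ (Y : ℝ) ≤ 1 - ε := by
    have h1 : (0:ℝ) < s := hs0
    have h2 : (0:ℝ) < 1 - Y := sub_pos.2 hY1
    refine ⟨min δ' (min s (1 - Y)), by positivity, min_le_left _ _,
      (min_le_right _ _).trans (min_le_left _ _), ?_⟩
    have := (min_le_right δ' (min (s:ℝ) (1 - Y))).trans (min_le_right _ _)
    linarith
  obtain ⟨w0, hw0, hw0c, hw0u⟩ := hsm ε hε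
  have hw0u' : ∀ x, s ≤ x → x ≤ Y → x < w0 x := fun x h1 h2 =>
    hw0u x (hε2.trans h1) (le_trans h2 hε3)
  -- escape times
  have hJ : ∀ i : Fin (N+2), ∃ J : ℕ, f ((f ^ (q * i)) t) < (w0 ^ J) ((f ^ (q * i)) t) := by
    intro i
    apply escape
    intro x h1 h2
    refine hw0u' x ((hst.trans (hfge t hst _)).trans h1) (h2.trans ?_)
    rw [← pow_succ_app]
    apply hYle
    have : (i:ℕ) ≤ N+1 := by omega
    have := Nat.mul_le_mul_left q this
    omega
  choose J hJ using hJ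
  have hn2 : ∀ i : Fin (N+2), ∃ n2 : ℕ, ∀ n ≥ n2, ∀ x, s ≤ x → x < 1 →
      (w ^ J i) ((f ^ n) x) < f ((f ^ n) x) := fun i => thresh hs1 hup (hwj (J i))
  choose n2 hn2 using hn2
  obtain ⟨n, hn, hnn2⟩ : ∃ n : ℕ, n ≥ max n0 n1 ∧ ∀ i, n ≥ n2 i := by
    refine ⟨max n0 n1 + ∑ i, n2 i, by omega, fun i => ?_⟩
    have := Finset.single_le_sum (f := n2) (fun _ _ => Nat.zero_le _) (Finset.mem_univ i)
    omega
  have hnn1 : n ≥ n1 := (le_max_right _ _).trans hn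
  have hc : ∀ i : Fin (N+2), ∃ c, (f ^ (q * i)) t ≤ c ∧ c ≤ f ((f ^ (q * i)) t) ∧
      kk f w n c < w0 c := by
    intro i
    have hsy : s ≤ (f ^ (q * (i:ℕ))) t := hst.trans (hfge t hst _)
    have hy1 : (f ^ (q * (i:ℕ))) t < 1 := app_lt_one _ ht
    refine slow w0 (kk f w n) (J := J i) hy1 ?_ ?_ (hJ i)
    · intro x h1 h2
      exact hkpos n hnn1 x (hsy.trans h1) h2
    · rw [kk_pow, inv_lt_iff, ← pow_succ_app', pow_succ_app]
      exact hn2 i n (hnn2 i) _ hsy hy1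
  choose c hc1 hc2 hc3 using hc
  obtain ⟨Z, hZ⟩ : ∃ Z : Fin (N+2) → I, ∀ i, Z i = (f ^ (q * (i:ℕ))) (X (n + q * i)) :=
    ⟨_, fun _ => rfl⟩
  have hXp : ∀ m, s ≤ X (n+m) ∧ X (n+m) ≤ t ∧ ((X (n+m)) : ℝ) + δ ≤ kk f w (n+m) (X (n+m)) :=
    fun m => hX (n+m) (by omega)
  have hZs : ∀ i : Fin (N+2), (f ^ (q * (i:ℕ))) s ≤ Z i := fun i => by
    rw [hZ]; exact (f ^ (q * (i:ℕ))).monotone (hXp _).1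
  have hZt : ∀ i : Fin (N+2), Z i ≤ (f ^ (q * (i:ℕ))) t := fun i => by
    rw [hZ]; exact (f ^ (q * (i:ℕ))).monotone (hXp _).2.1
  have hZk : ∀ i, w0 (Z i) < kk f w n (Z i) := by
    intro i
    have h1 := hgap i _ _ (hXp (q * i)).2.2
    rw [← kk_shift, ← hZ] at h1
    have h2 := (abs_lt.1 (hw0c (Z i))).2
    show (w0 (Z i) : ℝ) < _
    linarith
  -- the alternating sequence
  have hl : ∀ i : Fin (N+2), Z i < c i := by
    intro i
    refine lt_of_le_of_ne ((hZt i).trans (hc1 i)) ?_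
    intro h
    have h1 := hZk i
    have h2 := hc3 i
    rw [← h] at h2
    exact lt_asymm h1 h2
  have hr : ∀ i j : Fin (N+2), (j : ℕ) = i + 1 → c i < Z j := by
    intro i j hij
    calc c i ≤ f ((f ^ (q * (i:ℕ))) t) := hc2 i
      _ = (f ^ (q * (i:ℕ))) (f t) := by rw [← pow_succ_app, pow_succ_app']
      _ < (f ^ (q * (i:ℕ))) ((f ^ q) s) := (f ^ (q * (i:ℕ))).lt_iff_lt.2 hq
      _ = (f ^ (q * (j:ℕ))) s := by rw [hij, mul_add, mul_one, pow_add]; rfl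
      _ ≤ Z j := hZs j
  let ι : ℕ → Fin (N+2) := fun i => ⟨min (i/2) (N+1), by omega⟩
  have hι : ∀ i ≤ N+1, ((ι i : Fin (N+2)) : ℕ) = i/2 := fun i hi => by
    show min (i/2) (N+1) = i/2
    omega
  refine no_alt hfix (Γ.mul_mem (Γ.inv_mem hw0) (kk_mem hf hw n))
    (x := fun i => if Even i then Z (ι i) else c (ι i)) ⟨?_, ?_⟩
  · intro i hi
    by_cases he : Even i
    · have he' : ¬ Even (i+1) := by simpa [Nat.even_add_one] using he
      simp only [he, he', if_true, if_false]
      have : ι (i+1) = ι i := by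
        apply Fin.ext
        rw [hι _ (by omega), hι _ (by omega)]
        obtain ⟨r, hr⟩ := he
        omega
      rw [this]
      exact hl _
    · have he' : Even (i+1) := by simpa [Nat.even_add_one] using he
      simp only [he, he', if_true, if_false]
      apply hr
      rw [hι _ (by omega), hι _ (by omega)]
      obtain ⟨r, hr⟩ := Nat.not_even_iff_odd.1 he
      omega
  · intro i hi
    by_cases he : Even i
    · refine ⟨fun _ => ?_, fun h => absurd he h⟩
      simp only [he, if_true]
      rw [mul_app, lt_inv_iff]
      exact hZk _
    · refine ⟨fun h => absurd h he, fun _ => ?_⟩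
      simp only [he, if_false]
      rw [mul_app, inv_lt_iff]
      exact hc3 _

lemma bump (hfix : ∀ f ∈ Γ, f ≠ 1 → (interiorFixedPts f).encard ≤ (N : ℕ∞))
    (hsm : ∀ ε : ℝ, 0 < ε → ∃ w ∈ Γ, (∀ x : I, |(w x : ℝ) - x| < ε) ∧
      ∀ x : I, ε ≤ x → (x : ℝ) ≤ 1 - ε → x < w x)
    {f w : HomeoI} (hf : f ∈ Γ) (hw : w ∈ Γ) (hw1 : w ≠ 1) {b s t : I} (hbs : b < s)
    (hst : s ≤ t) (ht : t < 1) (hup : ∀ x, b < x → x < 1 → x < f x)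
    (hwj : ∀ j : ℤ, Ev fun z => (w ^ j) z < f z) {δ : ℝ} (hδ : 0 < δ) (n0 : ℕ) :
    ∃ n ≥ n0, ∀ x : I, s ≤ x → x ≤ t → |(kk f w n x : ℝ) - x| < δ := by
  rcases near_one hfix hw hw1 with hpos | hneg
  · obtain ⟨n, hn, h⟩ := bump_pos hfix hsm hf hw (lt_of_le_of_lt b.2.1 hbs) hst ht
      (fun x h1 h2 => hup x (hbs.trans_le h1) h2) hpos
      (fun j => by simpa using hwj j) hδ n0
    refine ⟨n, hn, fun x h1 h2 => ?_⟩
    obtain ⟨h3, h4⟩ := h x h1 h2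
    have h3' : (x : ℝ) < kk f w n x := h3
    rw [abs_lt]
    constructor <;> linarith
  · obtain ⟨s0, hs0, hs0'⟩ := exists_between hbs
    have hs0'' : (s0 : ℝ) < s := hs0'
    obtain ⟨δ0, hδ0, hδ1, hδ2⟩ : ∃ δ0 : ℝ, 0 < δ0 ∧ δ0 ≤ δ ∧ δ0 ≤ s - s0 :=
      ⟨min δ (s - s0), lt_min hδ (by linarith), min_le_left _ _, min_le_right _ _⟩
    obtain ⟨n, hn, h⟩ := bump_pos hfix hsm hf (Γ.inv_mem hw) (lt_of_le_of_lt b.2.1 hs0)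
      (hs0'.le.trans hst) ht
      (fun x h1 h2 => hup x (hs0.trans_le h1) h2) (hneg.comp w⁻¹ |>.mono fun z hz => by
        rw [app_inv] at hz; exact hz)
      (fun j => by simpa using hwj (-j)) hδ0 n0
    refine ⟨n, hn, fun x h1 h2 => ?_⟩
    rw [kk_inv] at h
    have h3 := (h x (hs0'.le.trans h1) h2).1
    have h3' : (kk f w n x : ℝ) < x := (lt_inv_iff _ _ _).1 h3
    have h1' : (s : ℝ) ≤ x := h1
    let y : I := ⟨x - δ0, by have := s0.2.1; linarith, by have := x.2.2; linarith⟩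
    have hy : (y : ℝ) = x - δ0 := rfl
    have h4 := (h y (show (s0 : ℝ) ≤ y by rw [hy]; linarith)
      (le_trans (show (y : ℝ) ≤ x by rw [hy]; linarith) h2)).2
    rw [hy] at h4
    have h5 : (kk f w n)⁻¹ y < x := show (_ : ℝ) < _ by linarith
    have h6 : (y : ℝ) < kk f w n x := (inv_lt_iff _ _ _).1 h5
    rw [abs_lt]
    constructor <;> linarith

end G

section G
variable {Γ : Subgroup HomeoI} {N : ℕ}

lemma step4 (hirr : IrreducibleSubgroup Γ)
    (hfix : ∀ f ∈ Γ, f ≠ 1 → (interiorFixedPts f).encard ≤ (N : ℕ∞))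
    (hsm : ∀ ε : ℝ, 0 < ε → ∃ w ∈ Γ, (∀ x : I, |(w x : ℝ) - x| < ε) ∧
      ∀ x : I, ε ≤ x → (x : ℝ) ≤ 1 - ε → x < w x)
    {f : HomeoI} (hf : f ∈ Γ) {a b : I} (ha0 : 0 < a) (hab : a < b) (hb1 : b < 1)
    (hfa : f a = a) (hfb : f b = b) (hnf : ∀ x, a < x → x < b → f x ≠ x)
    (hup : ∀ x, b < x → x < 1 → x < f x)
    {c : I} (hac : a < c) (hcb : c < b) {s t : I} (hbs : b < s) (hst : s ≤ t) (ht : t < 1)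
    {δ : ℝ} (hδ : 0 < δ) {e : I} (he : a < e) :
    ∃ γ ∈ Γ, (∀ x : I, s ≤ x → x ≤ t → |(γ x : ℝ) - x| < δ) ∧ γ c < e := by
  have hev : Ev fun z => z < f z := ⟨b, hb1, hup⟩
  have hwdn : ∀ q : I, 0 < q → q < 1 → f q = q →
      ∃ w ∈ Γ, w ≠ 1 ∧ w q < q ∧ ∀ j : ℤ, Ev fun z => (w ^ j) z < f z := by
    intro q h0 h1 hq
    obtain ⟨w, hw, hwq, hwj⟩ := step3 hirr hfix hf hev h0 h1 hq
    rcases lt_or_gt_of_ne hwq with h | h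
    · refine ⟨w, hw, ?_, h, hwj⟩
      rintro rfl
      exact hwq rfl
    · refine ⟨w⁻¹, Γ.inv_mem hw, ?_, (inv_lt_iff _ _ _).2 h, fun j => ?_⟩
      · intro hc
        rw [inv_eq_one] at hc
        rw [hc] at hwq
        exact hwq rfl
      · have := hwj (-j)
        rw [zpow_neg] at this
        rw [inv_zpow]
        exact this
  rcases sign_cases f (S := Set.Ioo a b) Set.ordConnected_Ioo (fun x hx => hnf x hx.1 hx.2)
    with hs | hs
  · obtain ⟨w, hw, hw1, hwb, hwj⟩ := hwdn b (ha0.trans hab) hb1 hfb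
    obtain ⟨n0, hn0⟩ := iter_down f⁻¹ (inv_fix hfa) (q := max (w b) c) (y := e)
      (hac.trans_le (le_max_right _ _)) (by
        intro x h1 h2
        rw [inv_lt_iff]
        exact hs x ⟨h1, h2.trans_lt (max_lt hwb hcb)⟩) he
    obtain ⟨n, hn, hcl⟩ := bump hfix hsm hf hw hw1 hbs hst ht hup hwj hδ n0
    refine ⟨kk f w n, kk_mem hf hw n, hcl, ?_⟩
    have h1 : (f ^ n) c < b := by
      have := (f ^ n).lt_iff_lt.2 hcb
      rwa [pow_fix hfb] at this
    rw [kk_app]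
    calc (f ^ n)⁻¹ (w ((f ^ n) c)) ≤ (f ^ n)⁻¹ (max (w b) c) :=
          (f ^ n)⁻¹.monotone ((w.monotone h1.le).trans (le_max_left _ _))
      _ < e := by
        rw [← inv_pow]
        exact (hn0 n hn).2.1
  · obtain ⟨w, hw, hw1, hwa, hwj⟩ := hwdn a ha0 (hab.trans hb1) hfa
    obtain ⟨n0, hn0⟩ := iter_down f hfa (q := c) (y := w⁻¹ a) hac (by
        intro x h1 h2
        exact hs x ⟨h1, h2.trans_lt hcb⟩) ((lt_inv_iff _ _ _).2 hwa)
    obtain ⟨n, hn, hcl⟩ := bump hfix hsm hf hw hw1 hbs hst ht hup hwj hδ n0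
    refine ⟨kk f w n, kk_mem hf hw n, hcl, ?_⟩
    rw [kk_app, inv_lt_iff]
    have h1 := (lt_inv_iff _ _ _).1 (hn0 n hn).2.1
    refine h1.trans ?_
    have := (f ^ n).lt_iff_lt.2 he
    rwa [pow_fix hfa] at this

/-- `P x b y`: elements close to the identity on the right of `b` sending `x` below `y` -/
def PP (Γ : Subgroup HomeoI) (b x y : I) : Prop :=
  ∀ s t : I, b < s → s ≤ t → t < 1 → ∀ δ : ℝ, 0 < δ →
    ∃ γ ∈ Γ, (∀ z : I, s ≤ z → z ≤ t → |(γ z : ℝ) - z| < δ) ∧ γ x < y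

lemma step5_aux {a b x e : I} (hsm : ∀ ε : ℝ, 0 < ε → ∃ w ∈ Γ, (∀ x : I, |(w x : ℝ) - x| < ε) ∧
      ∀ x : I, ε ≤ x → (x : ℝ) ≤ 1 - ε → x < w x)
    (hab : a < b) (hb1 : b < 1) (he0 : 0 < e) (hea : e ≤ a)
    (h4 : ∀ c, a < c → c < b → ∀ y, a < y → PP Γ b c y) (hP : ∀ y, e < y → PP Γ b x y) :
    ∃ y < e, PP Γ b x y := by
  obtain ⟨ε, hε, hε1, hε2, hε3⟩ : ∃ ε : ℝ, 0 < ε ∧ ε ≤ e ∧ (b : ℝ) ≤ 1 - ε ∧ ε ≤ b - a := by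
    have h1 : (0:ℝ) < e := he0
    have h2 : (0:ℝ) < 1 - b := sub_pos.2 hb1
    have h3 : (0:ℝ) < b - a := sub_pos.2 hab
    refine ⟨min e (min (1 - b) (b - a)), by positivity, min_le_left _ _, ?_,
      (min_le_right _ _).trans (min_le_right _ _)⟩
    have := (min_le_right (e:ℝ) (min (1 - (b:ℝ)) (b - a))).trans (min_le_left _ _)
    linarith
  obtain ⟨w0, hw0, hw0c, hw0u⟩ := hsm ε hε
  have hw0u' : ∀ z, e ≤ z → z ≤ b → z < w0 z := fun z h1 h2 =>
    hw0u z (hε1.trans h1) (le_trans (show (z : ℝ) ≤ b from h2) hε2)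
  have hesc : ∃ m : ℕ, a < (w0 ^ m) e :=
    escape w0 (fun z h1 h2 => hw0u' z h1 (h2.trans hab.le))
  classical
  have hm := Nat.find_spec hesc
  obtain ⟨u, hu, hue1, hue2, hub⟩ : ∃ u ∈ Γ, a < u e ∧ u e < b ∧ b ≤ u b := by
    refine ⟨w0 ^ (Nat.find hesc), Γ.pow_mem hw0 _, hm, ?_, ?_⟩
    · rcases hfm : Nat.find hesc with _ | m
      · rw [hfm] at hm
        exact absurd hm (not_lt.2 hea)
      · have h1 := Nat.find_min hesc (m := m) (by omega)
        push Not at h1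
        rw [pow_succ_app]
        have h2 := (abs_lt.1 (hw0c ((w0 ^ m) e))).2
        have h3 : ((w0 ^ m) e : ℝ) ≤ a := h1
        show (_ : ℝ) < b
        linarith
    · have hw0b : b < w0 b := hw0u' b (hea.trans hab.le) le_rfl
      have : ∀ m : ℕ, b ≤ (w0 ^ m) b := by
        intro m
        induction m with
        | zero => exact le_rfl
        | succ m ih =>
          rw [pow_succ_app']
          exact ih.trans ((w0 ^ m).monotone hw0b.le)
      exact this _
  obtain ⟨c', hc1, hc2⟩ := exists_between hue2
  obtain ⟨y0, hy1, hy2⟩ := exists_between hue1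
  refine ⟨u⁻¹ y0, (inv_lt_iff _ _ _).2 hy2, ?_⟩
  intro s t hbs hst ht δ hδ
  obtain ⟨s', hs1, hs2⟩ := exists_between hbs
  obtain ⟨t', ht1, ht2⟩ := exists_between ht
  have hs2' : (s' : ℝ) < s := hs2
  have ht1' : (t : ℝ) < t' := ht1
  obtain ⟨δ1, hδ1, hδ1a, hδ1b, hδ1c⟩ : ∃ δ1 : ℝ, 0 < δ1 ∧ δ1 ≤ δ / 2 ∧ δ1 ≤ s - s' ∧ δ1 ≤ t' - t := by
    have h2 : (0:ℝ) < s - s' := sub_pos.2 hs2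
    have h3 : (0:ℝ) < t' - t := sub_pos.2 ht1
    exact ⟨min (δ/2) (min (s - s') (t' - t)), by positivity, min_le_left _ _,
      (min_le_right _ _).trans (min_le_left _ _), (min_le_right _ _).trans (min_le_right _ _)⟩
  obtain ⟨γ, hγ, hγc, hγx⟩ := hP (u⁻¹ c') ((lt_inv_iff _ _ _).2 hc1) s t hbs hst ht δ1 hδ1
  have huc := CompactSpace.uniformContinuous_of_continuous (cont u⁻¹)
  obtain ⟨δ2, hδ2, huc⟩ := Metric.uniformContinuous_iff.1 huc (δ/2) (by positivity)
  obtain ⟨k, hk, hkc, hkx⟩ := h4 c' (hue1.trans hc1) hc2 y0 hy1 (u s') (u t')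
    (hub.trans_lt (u.lt_iff_lt.2 hs1)) (u.monotone ((hs2.le.trans hst).trans ht1.le))
    (app_lt_one _ ht2) δ2 hδ2
  refine ⟨u⁻¹ * k * u * γ, Γ.mul_mem (Γ.mul_mem (Γ.mul_mem (Γ.inv_mem hu) hk) hu) hγ, ?_, ?_⟩
  · intro z hz1 hz2
    have h1 := abs_lt.1 (hγc z hz1 hz2)
    have hz1' : (s : ℝ) ≤ z := hz1
    have hz2' : (z : ℝ) ≤ t := hz2
    have h2 : s' ≤ γ z := show (s' : ℝ) ≤ γ z by linarith [h1.1]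
    have h3 : γ z ≤ t' := show (γ z : ℝ) ≤ t' by linarith [h1.2]
    have h5 := hkc (u (γ z)) (u.monotone h2) (u.monotone h3)
    have h6 := huc (show dist (k (u (γ z))) (u (γ z)) < δ2 from h5)
    rw [inv_app] at h6
    have h7 : |((u⁻¹ (k (u (γ z))) : I) : ℝ) - γ z| < δ / 2 := h6
    have h8 := abs_lt.1 h7
    show |((u⁻¹ (k (u (γ z))) : I) : ℝ) - z| < δ
    rw [abs_lt]
    constructor <;> linarith [h1.1, h1.2, h8.1, h8.2]
  · show u⁻¹ (k (u (γ x))) < u⁻¹ y0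
    rw [u⁻¹.lt_iff_lt]
    refine lt_trans (k.lt_iff_lt.2 ?_) hkx
    exact (lt_inv_iff _ _ _).1 hγx

lemma step5 {a b x : I} (hsm : ∀ ε : ℝ, 0 < ε → ∃ w ∈ Γ, (∀ x : I, |(w x : ℝ) - x| < ε) ∧
      ∀ x : I, ε ≤ x → (x : ℝ) ≤ 1 - ε → x < w x)
    (hab : a < b) (hb1 : b < 1)
    (h4 : ∀ c, a < c → c < b → ∀ y, a < y → PP Γ b c y) (hax : a < x) (hxb : x < b)
    (c : I) (hc : 0 < c) : PP Γ b x c := by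
  obtain ⟨e, he⟩ : ∃ e, e = sInf {y | PP Γ b x y} := ⟨_, rfl⟩
  have hP : ∀ y, e < y → PP Γ b x y := by
    intro y hy
    rw [he] at hy
    obtain ⟨y', hy', hlt⟩ := sInf_lt_iff.1 hy
    intro s t h1 h2 h3 δ hδ
    obtain ⟨γ, hγ, h5, h6⟩ := hy' s t h1 h2 h3 δ hδ
    exact ⟨γ, hγ, h5, h6.trans hlt⟩
  have hea : e ≤ a := by
    by_contra hcon
    push Not at hcon
    obtain ⟨y, hy1, hy2⟩ := exists_between hcon
    have : e ≤ y := by rw [he]; exact sInf_le (h4 x hax hxb y hy1)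
    exact absurd hy2 (not_lt.2 this)
  have he0 : ¬ 0 < e := by
    intro he0
    obtain ⟨y, hy, hPy⟩ := step5_aux hsm hab hb1 he0 hea h4 hP
    have : e ≤ y := by rw [he]; exact sInf_le hPy
    exact absurd hy (not_lt.2 this)
  exact hP c ((not_lt.1 he0).trans_lt hc)

lemma alt_mono {m : ℕ} {g : HomeoI} {x : ℕ → I} (h : Alt m g x) {i j : ℕ} (hij : i ≤ j)
    (hj : j ≤ m) : x i ≤ x j := by
  induction j, hij using Nat.le_induction with
  | base => exact le_rfl
  | succ j hij ih => exact (ih (by omega)).trans (h.1 j (by omega)).le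

lemma alt_ne {m : ℕ} {g : HomeoI} {x : ℕ → I} (h : Alt m g x) {i : ℕ} (hi : i ≤ m) :
    g (x i) ≠ x i := by
  by_cases he : Even i
  · exact ((h.2 i hi).1 he).ne'
  · exact ((h.2 i hi).2 he).ne

lemma ne_zero_of_moved {g : HomeoI} {x : I} (h : g x ≠ x) : 0 < x := by
  refine lt_of_le_of_ne x.2.1 ?_
  rintro rfl
  exact h (app_zero g)

lemma ne_one_of_moved {g : HomeoI} {x : I} (h : g x ≠ x) : x < 1 := by
  refine lt_of_le_of_ne x.2.2 ?_
  rintro rfl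
  exact h (app_one g)

lemma step6 (hirr : IrreducibleSubgroup Γ) {a b x : I} (hab : a < b) (hb1 : b < 1)
    (hax : a < x) (hxb : x < b) (h5 : ∀ c, 0 < c → PP Γ b x c) (m : ℕ) :
    ∃ g ∈ Γ, ∃ y : ℕ → I, Alt m g y := by
  have hx0 : 0 < x := lt_of_le_of_lt a.2.1 hax
  induction m with
  | zero =>
    obtain ⟨h, hh, hne⟩ := hirr x hx0 (hxb.trans hb1)
    obtain ⟨g, hg, hgx⟩ : ∃ g ∈ Γ, x < g x := by
      rcases lt_or_gt_of_ne hne with h' | h'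
      · exact ⟨h⁻¹, Γ.inv_mem hh, (lt_inv_iff _ _ _).2 h'⟩
      · exact ⟨h, hh, h'⟩
    refine ⟨g, hg, fun _ => x, fun i hi => absurd hi (by omega), fun i hi => ⟨fun _ => hgx, fun he => ?_⟩⟩
    have : i = 0 := by omega
    rw [this] at he
    simp at he
  | succ m ih =>
    obtain ⟨g0, hg0, y0, hA0⟩ := ih
    obtain ⟨h, hh, hhy⟩ := orbit_high hirr (ne_zero_of_moved (alt_ne hA0 (Nat.zero_le m))) hb1
    obtain ⟨g, hg, y, hA, hby⟩ : ∃ g ∈ Γ, ∃ y : ℕ → I, Alt m g y ∧ b < y 0 := by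
      refine ⟨h * g0 * h⁻¹, Γ.mul_mem (Γ.mul_mem hh hg0) (Γ.inv_mem hh), fun i => h (y0 i), ⟨?_, ?_⟩, hhy⟩
      · intro i hi
        exact h.lt_iff_lt.2 (hA0.1 i hi)
      · intro i hi
        simp only [mul_app, inv_app, h.lt_iff_lt]
        exact hA0.2 i hi
    have hy0 : y 0 < g (y 0) := (hA.2 0 (Nat.zero_le m)).1 (by simp)
    have hym : y m < 1 := ne_one_of_moved (alt_ne hA le_rfl)
    obtain ⟨δ, hδ, hδ'⟩ : ∃ r > 0, ∀ i : Fin (m+1), r ≤ |(g (y i) : ℝ) - y i| := by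
      apply fin_rho (P := fun (i : Fin (m+1)) (r : ℝ) => r ≤ |(g (y i) : ℝ) - y i|)
      intro i
      refine ⟨|(g (y i) : ℝ) - y i|, ?_, fun r' _ hle => hle⟩
      apply abs_pos.2
      intro h0
      exact alt_ne hA (i := i) (by omega) (Subtype.ext (sub_eq_zero.1 h0))
    obtain ⟨z, hz⟩ : ∃ z, z = g⁻¹ x := ⟨_, rfl⟩
    have hgz : g z = x := by rw [hz, app_inv]
    obtain ⟨γ, hγ, hγc, hγx⟩ := h5 z (by rw [hz]; exact app_pos _ hx0) (g (y 0)) (g (y m))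
      (hby.trans hy0) (g.monotone (alt_mono hA (Nat.zero_le m) le_rfl)) (app_lt_one _ hym) δ hδ
    have hcl : ∀ i ≤ m, |(γ (g (y i)) : ℝ) - g (y i)| < |(g (y i) : ℝ) - y i| := by
      intro i hi
      have h1 := hγc (g (y i)) (g.monotone (alt_mono hA (Nat.zero_le i) hi))
        (g.monotone (alt_mono hA hi le_rfl))
      exact h1.trans_le (hδ' ⟨i, by omega⟩)
    refine ⟨(γ * g)⁻¹, Γ.inv_mem (Γ.mul_mem hγ hg),
      fun i => Nat.casesOn i z (fun i => y i), ⟨?_, ?_⟩⟩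
    · intro i hi
      cases i with
      | zero =>
        show z < y 0
        rw [hz, inv_lt_iff]
        exact (hxb.trans hby).trans hy0
      | succ i => exact hA.1 i (by omega)
    · intro i hi
      cases i with
      | zero =>
        refine ⟨fun _ => ?_, fun h => absurd (by simp) h⟩
        show z < (γ * g)⁻¹ z
        rw [lt_inv_iff, mul_app, hgz]
        exact hγx
      | succ i =>
        have h1 := hcl i (by omega)
        have h2 := hA.2 i (by omega)
        show (Even (i+1) → y i < (γ * g)⁻¹ (y i)) ∧ (¬ Even (i+1) → (γ * g)⁻¹ (y i) < y i)
        rw [Nat.even_add_one, not_not, lt_inv_iff, inv_lt_iff, mul_app]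
        constructor
        · intro he
          have h3 : (g (y i) : ℝ) < y i := h2.2 he
          rw [abs_of_neg (a := (g (y i) : ℝ) - y i) (by linarith)] at h1
          show (_ : ℝ) < _
          linarith [(abs_lt.1 h1).2]
        · intro he
          have h3 : (y i : ℝ) < g (y i) := h2.1 he
          rw [abs_of_pos (a := (g (y i) : ℝ) - y i) (by linarith)] at h1
          show (_ : ℝ) < _
          linarith [(abs_lt.1 h1).1]

lemma main (hdiff : ∀ f ∈ Γ, IsC1DiffeoI f)
    (hirr : IrreducibleSubgroup Γ)
    (hfix : ∀ f ∈ Γ, f ≠ 1 → (interiorFixedPts f).encard ≤ (N : ℕ∞)) :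
    ∀ f ∈ Γ, f ≠ 1 → (interiorFixedPts f).encard ≤ 1 := by
  intro f0 hf0 hf1
  by_contra hcon
  push Not at hcon
  obtain ⟨p, q, hp, hq, hpq⟩ := Set.one_lt_encard_iff.1 hcon
  have hfin := fin_fix hfix hf0 hf1
  have hsm : ∀ ε : ℝ, 0 < ε → ∃ w ∈ Γ, (∀ x : I, |(w x : ℝ) - x| < ε) ∧
      ∀ x : I, ε ≤ x → (x : ℝ) ≤ 1 - ε → x < w x := fun ε hε =>
    small hirr hfix (fun k => pigeonΓ hdiff hirr hfix hf0 hf1 ⟨p, hp⟩ k) hε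
  obtain ⟨b, hb, hbm⟩ := Set.exists_max_image _ id hfin ⟨p, hp⟩
  obtain ⟨a, ⟨ha, hab'⟩, ham⟩ := Set.exists_max_image (interiorFixedPts f0 \ {b}) id hfin.diff (by
    by_cases h : p = b
    · exact ⟨q, hq, fun h' => hpq (h.trans h'.symm)⟩
    · exact ⟨p, hp, h⟩)
  obtain ⟨hfb, hb0, hb1⟩ := mem_ifp.1 hb
  obtain ⟨hfa, ha0, ha1⟩ := mem_ifp.1 ha
  have hab : a < b := lt_of_le_of_ne (hbm a ha) hab'
  have hnf : ∀ x, a < x → x < b → f0 x ≠ x := by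
    intro x h1 h2 h3
    exact absurd (ham x ⟨mem_ifp.2 ⟨h3, ha0.trans h1, h2.trans hb1⟩, h2.ne⟩) (not_le.2 h1)
  have hnf2 : ∀ x ∈ Set.Ioo b 1, f0 x ≠ x := by
    rintro x ⟨h1, h2⟩ h3
    exact absurd (hbm x (mem_ifp.2 ⟨h3, hb0.trans h1, h2⟩)) (not_le.2 h1)
  obtain ⟨f, hf, hfa', hfb', hnf', hup⟩ : ∃ f ∈ Γ, f a = a ∧ f b = b ∧
      (∀ x, a < x → x < b → f x ≠ x) ∧ ∀ x, b < x → x < 1 → x < f x := by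
    rcases sign_cases f0 Set.ordConnected_Ioo hnf2 with h | h
    · exact ⟨f0, hf0, hfa, hfb, hnf, fun x h1 h2 => h x ⟨h1, h2⟩⟩
    · refine ⟨f0⁻¹, Γ.inv_mem hf0, inv_fix hfa, inv_fix hfb, ?_, ?_⟩
      · intro x h1 h2 h3
        exact hnf x h1 h2 ((inv_eq_iff _ _ _).1 h3).symm
      · intro x h1 h2
        rw [lt_inv_iff]
        exact h x ⟨h1, h2⟩
  obtain ⟨x, hax, hxb⟩ := exists_between hab
  have h4 : ∀ c, a < c → c < b → ∀ y, a < y → PP Γ b c y := by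
    intro c h1 h2 y hy s t h5 h6 h7 δ hδ
    exact step4 hirr hfix hsm hf ha0 hab hb1 hfa' hfb' hnf' hup h1 h2 h5 h6 h7 hδ hy
  obtain ⟨g, hg, y, hA⟩ := step6 hirr hab hb1 hax hxb
    (fun c hc => step5 hsm hab hb1 h4 hax hxb c hc) (N+1)
  exact no_alt hfix hg hA

end G

end Prf

/-- Let `N ≥ 2` and let `Γ` be an irreducible subgroup of `Diff₊(I)`
such that every non-identity element of `Γ` has at most `N` fixed points in `(0,1)`.
Then in fact every non-identity element of `Γ` has at most one fixed point in `(0,1)`. -/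
theorem irreducible_boundedFixedPoints_atMostOneFixedPoint
    (N : ℕ) (hN : 2 ≤ N) (Γ : Subgroup HomeoI)
    (hdiff : ∀ f ∈ Γ, IsC1DiffeoI f)
    (hirr : IrreducibleSubgroup Γ)
    (hfix : ∀ f ∈ Γ, f ≠ 1 → (interiorFixedPts f).encard ≤ (N : ℕ∞)) :
    ∀ f ∈ Γ, f ≠ 1 → (interiorFixedPts f).encard ≤ 1 := by
  exact Prf.main hdiff hirr hfix

end
end
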